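/- arXiv:1902.01361 — 4 statements merged into one kernel-verified Lean document; each statement's English description precedes it below -/
import Mathlib

section
/- Let L ≠ ∂^n be an operator of order n in normal form in A₁(ℂ), i.e. L = ∂^n + u_{n−2}∂^{n−2} + ⋯ + u_0 with u_j ∈ ℂ[x]. Then there exists a unique linear form Λ_{p,q}(i,j) = pi + qj, with p, q nonnegative coprime integers and p + q > 0, such that δ_{p,q}(L) = Λ_{p,q}(0,n) and Λ_{p,q}(0,n) = Λ_{p,q}(a,b) for some (a,b) ∈ 𝒩(L) \ {(0,n)}. -/
open scoped BigOperators

/-- Multiplication by `x` on `ℂ[x]`. -/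
noncomputable def Wx : Module.End ℂ (Polynomial ℂ) := LinearMap.mulLeft ℂ Polynomial.X

/-- The derivation `∂ = d/dx` on `ℂ[x]`. -/
noncomputable def Wd : Module.End ℂ (Polynomial ℂ) := Polynomial.derivative

/-- The element `Σ c_{ij} x^i ∂^j` of the first Weyl algebra `A₁(ℂ)`. -/
noncomputable def toOp (c : (ℕ × ℕ) →₀ ℂ) : Module.End ℂ (Polynomial ℂ) :=
  c.sum fun ij z => z • (Wx ^ ij.1 * Wd ^ ij.2)

/-- Coprime pairs of natural numbers that are proportional are equal. -/
theorem Nat.Coprime.prod_eq_of_mul_eq_mul {p q p' q' : ℕ} (h : p.Coprime q) (h' : p'.Coprime q')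
    (e : p * q' = p' * q) : p = p' ∧ q = q' := by
  constructor
  · exact Nat.dvd_antisymm (h.dvd_of_dvd_mul_right (Dvd.intro _ e))
      (h'.dvd_of_dvd_mul_right (Dvd.intro _ e.symm))
  · exact Nat.dvd_antisymm (h.symm.dvd_of_dvd_mul_left (Dvd.intro_left _ e.symm))
      (h'.symm.dvd_of_dvd_mul_left (Dvd.intro_left _ e))

/-- A nonempty finite set of fractions `a / d` with `d > 0` has a maximum, which is
`q / p` for exactly one coprime pair `(p, q)`. -/
theorem Finset.existsUnique_coprime_max_ratio (S : Finset (ℕ × ℕ)) (hS : S.Nonempty)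
    (hpos : ∀ s ∈ S, 0 < s.2) :
    ∃! pq : ℕ × ℕ, Nat.Coprime pq.1 pq.2 ∧ (∀ s ∈ S, pq.1 * s.1 ≤ pq.2 * s.2) ∧
      ∃ s ∈ S, pq.1 * s.1 = pq.2 * s.2 := by
  obtain ⟨⟨a, d⟩, hm, hmax⟩ := S.exists_max_image (fun s => (s.1 : ℚ) / s.2) hS
  have hd : 0 < d := hpos _ hm
  have hcross : ∀ s ∈ S, s.1 * d ≤ a * s.2 := by
    intro s hs
    have h := hmax s hs
    have hs2 : (0 : ℚ) < s.2 := by exact_mod_cast hpos s hs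
    rw [div_le_div_iff₀ hs2 (by exact_mod_cast hd)] at h
    exact_mod_cast h
  obtain ⟨g, p, q, hg, hcop, hp, hq⟩ := Nat.exists_coprime' (m := d) (n := a)
    (Nat.gcd_pos_of_pos_left _ hd)
  have hle : ∀ s ∈ S, p * s.1 ≤ q * s.2 := by
    intro s hs
    have h := hcross s hs
    rw [hp, hq] at h
    refine le_of_mul_le_mul_right ?_ hg
    linarith
  have heq : p * a = q * d := by rw [hp, hq]; ring
  refine ⟨(p, q), ⟨hcop, hle, (a, d), hm, heq⟩, ?_⟩
  rintro ⟨p', q'⟩ ⟨hcop', hle', ⟨a', d'⟩, hm', heq'⟩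
  have hd' : 0 < d' := hpos _ hm'
  have h₁ : p' * q ≤ p * q' := by
    have h := hle' _ hm
    dsimp only at h
    refine le_of_mul_le_mul_right ?_ hd
    calc p' * q * d = p * (p' * a) := by rw [mul_assoc, ← heq]; ring
      _ ≤ p * (q' * d) := Nat.mul_le_mul_left _ h
      _ = p * q' * d := by ring
  have h₂ : p * q' ≤ p' * q := by
    have h := hle _ hm'
    dsimp only at h heq'
    refine le_of_mul_le_mul_right ?_ hd'
    calc p * q' * d' = p' * (p * a') := by rw [mul_assoc, ← heq']; ring
      _ ≤ p' * (q * d') := Nat.mul_le_mul_left _ h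
      _ = p' * q * d' := by ring
  obtain ⟨rfl, rfl⟩ := hcop.prod_eq_of_mul_eq_mul hcop' (le_antisymm h₂ h₁)
  rfl

/-- Let `L ≠ ∂^n` be an operator of order `n` in normal form in `A₁(ℂ)`,
i.e. `L = ∂^n + u_{n-2} ∂^{n-2} + ⋯ + u_0` with `u_j ∈ ℂ[x]`.  Then there is a unique
linear form `Λ_{p,q}(i,j) = p i + q j` with `p, q` nonnegative coprime integers,
`p + q > 0`, such that `δ_{p,q}(L) = Λ_{p,q}(0,n)` and `Λ_{p,q}(0,n) = Λ_{p,q}(a,b)`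
for some `(a,b) ∈ 𝒩(L) \ {(0,n)}`. -/
theorem statement12 (n : ℕ) (hn : 0 < n)
    (c : (ℕ × ℕ) →₀ ℂ) (L : Module.End ℂ (Polynomial ℂ)) (hL : L = toOp c)
    (hord : ∀ ij ∈ c.support, ij.2 ≤ n)
    (hlead : c (0, n) = 1)
    (hlead' : ∀ i, i ≠ 0 → c (i, n) = 0)
    (hnormal : ∀ i, c (i, n - 1) = 0)
    (hne : c ≠ Finsupp.single (0, n) 1) :
    ∃! pq : ℕ × ℕ, Nat.Coprime pq.1 pq.2 ∧ 0 < pq.1 + pq.2 ∧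
      (c.support.sup fun ij => pq.1 * ij.1 + pq.2 * ij.2) = pq.2 * n ∧
      ∃ ab ∈ c.support, ab ≠ (0, n) ∧ pq.1 * ab.1 + pq.2 * ab.2 = pq.2 * n := by
  classical
  have hmem : (0, n) ∈ c.support := by simp [hlead]
  have hlt : ∀ ij ∈ c.support, ij ≠ (0, n) → ij.2 < n := by
    rintro ⟨i, j⟩ hij hij0
    refine lt_of_le_of_ne (hord _ hij) ?_
    rintro rfl
    exact Finsupp.mem_support_iff.1 hij (hlead' i fun hi => hij0 (by rw [hi]))
  have hnonempty : (c.support.erase (0, n)).Nonempty := by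
    by_contra h
    rw [Finset.not_nonempty_iff_eq_empty, Finset.erase_eq_empty_iff] at h
    refine hne (Finsupp.ext fun ij => ?_)
    by_cases h0 : ij = (0, n)
    · simp [h0, hlead]
    · rw [Finsupp.single_eq_of_ne h0, ← Finsupp.notMem_support_iff]
      rcases h with h | h <;> simp [h, h0]
  have key := Finset.existsUnique_coprime_max_ratio
    ((c.support.erase (0, n)).image fun ij => (ij.1, n - ij.2)) (hnonempty.image _) (by
      simp only [Finset.mem_image, Finset.mem_erase]
      rintro _ ⟨ij, ⟨h0, hij⟩, rfl⟩
      exact Nat.sub_pos_of_lt (hlt ij hij h0))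
  refine (existsUnique_congr fun pq => ?_).1 key
  obtain ⟨p, q⟩ := pq
  have hsub : ∀ ij ∈ c.support, q * (n - ij.2) + q * ij.2 = q * n := fun ij hij => by
    rw [← mul_add, Nat.sub_add_cancel (hord ij hij)]
  simp only [Finset.mem_image, Finset.mem_erase, forall_exists_index, and_imp,
    exists_exists_and_eq_and]
  refine and_congr_right fun hcop => ?_
  have hpq : 0 < p + q := by
    rcases Nat.eq_zero_or_pos (p + q) with h | h
    · obtain ⟨rfl, rfl⟩ := Nat.add_eq_zero_iff.1 h
      simp at hcop
    · exact h
  have hsup : (c.support.sup fun ij => p * ij.1 + q * ij.2) = q * n ↔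
      ∀ ij, ij ≠ (0, n) → ij ∈ c.support → p * ij.1 ≤ q * (n - ij.2) := by
    constructor
    · intro h ij _ hij
      have h1 := Finset.le_sup (f := fun ij : ℕ × ℕ => p * ij.1 + q * ij.2) hij
      have h2 := hsub ij hij
      simp only [h] at h1
      lia
    · intro h
      refine le_antisymm (Finset.sup_le fun ij hij => ?_) ?_
      · by_cases h0 : ij = (0, n)
        · simp [h0]
        · have h1 := h ij h0 hij
          have h2 := hsub ij hij
          lia
      · simpa using Finset.le_sup (f := fun ij : ℕ × ℕ => p * ij.1 + q * ij.2) hmem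
  rw [hsup]
  simp only [hpq, true_and]
  refine and_congr ⟨fun h ij h0 hij => h _ ij h0 hij rfl, ?_⟩ (exists_congr fun ij => ?_)
  · rintro h _ ij h0 hij rfl
    exact h ij h0 hij
  constructor
  · rintro ⟨⟨h0, hij⟩, h⟩
    have := hsub ij hij
    exact ⟨hij, h0, by lia⟩
  · rintro ⟨hij, h0, h⟩
    have := hsub ij hij
    exact ⟨⟨h0, hij⟩, by lia⟩
end

section
/- Let L₄ = (∂² + V(x))² + U(x)∂ + W(x) be an irreducible operator of order 4 in A₁(ℂ), with U, V, W ∈ ℂ[x]. Assume deg(V) > max{(1/2)deg(U), (1/2)deg(W)}. Then every nonzero operator M in A₁(ℂ) commuting with L₄ has even order. -/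
open scoped BigOperators

/-- Multiplication by the polynomial `V` on `ℂ[x]`. -/
noncomputable def mulP (V : Polynomial ℂ) : Module.End ℂ (Polynomial ℂ) :=
  LinearMap.mulLeft ℂ V

/-- Membership in the first Weyl algebra `A₁(ℂ)`. -/
def InWeyl (P : Module.End ℂ (Polynomial ℂ)) : Prop :=
  ∃ c : (ℕ × ℕ) →₀ ℂ, P = toOp c

/-- `OrdW P k` : `P ∈ A₁(ℂ)` is nonzero of order (degree in `∂`) `k`. -/
def OrdW (P : Module.End ℂ (Polynomial ℂ)) (k : ℕ) : Prop :=
  ∃ c : (ℕ × ℕ) →₀ ℂ, P = toOp c ∧ c ≠ 0 ∧ k = c.support.sup (fun ij => ij.2)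

/-- `L` is irreducible in `A₁(ℂ)`: it is not a product of two operators of positive
order. -/
def IrreducibleOp (L : Module.End ℂ (Polynomial ℂ)) : Prop :=
  ¬ ∃ P Q : Module.End ℂ (Polynomial ℂ), InWeyl P ∧ InWeyl Q ∧
    (∃ k, 0 < k ∧ OrdW P k) ∧ (∃ k, 0 < k ∧ OrdW Q k) ∧ L = P * Q

open Polynomial

/-- Additive properties of bivariate polynomials can be checked on monomials. -/
theorem bivariate_induction {motive : ℂ[X][X] → Prop} (P : ℂ[X][X])
    (add : ∀ P Q, motive P → motive Q → motive (P + Q))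
    (monomial : ∀ j i c, motive (monomial j (monomial i c))) : motive P := by
  induction P using Polynomial.induction_on' with
  | add P Q hP hQ => exact add P Q hP hQ
  | monomial j a =>
    induction a using Polynomial.induction_on' with
    | add a b ha hb => rw [map_add]; exact add _ _ ha hb
    | monomial i c => exact monomial j i c

/-- The derivative with respect to `x` of a symbol in `ℂ[x][ξ]`. -/
noncomputable def derivX : ℂ[X][X] →+ ℂ[X][X] where
  toFun P := P.sum fun j a => monomial j (derivative a)
  map_zero' := by simp
  map_add' P Q := Polynomial.sum_add_index P Q _ (by simp) (by simp)

theorem derivX_monomial (j : ℕ) (a : ℂ[X]) :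
    derivX (monomial j a) = monomial j (derivative a) := by
  simp [derivX, Polynomial.sum_monomial_index]

theorem iterate_derivX_monomial (k j : ℕ) (a : ℂ[X]) :
    derivX^[k] (monomial j a) = monomial j (derivative^[k] a) := by
  induction k with
  | zero => rfl
  | succ k ih => rw [Function.iterate_succ_apply', ih, derivX_monomial,
      Function.iterate_succ_apply']

/-- The differential operator `∑ aⱼ ∂ʲ` with symbol `∑ aⱼ ξʲ`. -/
noncomputable def symbolOp : ℂ[X][X] →+ Module.End ℂ ℂ[X] where
  toFun P := P.sum fun j a => mulP a * Wd ^ j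
  map_zero' := by simp
  map_add' P Q := by
    apply Polynomial.sum_add_index
    · intro j; ext; simp [mulP]
    · intro j a b
      rw [← add_mul]
      congr 1
      ext; simp [mulP, add_mul]

theorem symbolOp_monomial_apply (j : ℕ) (a f : ℂ[X]) :
    symbolOp (monomial j a) f = a * derivative^[j] f := by
  change (Polynomial.sum (monomial j a) fun j a => mulP a * Wd ^ j) f = _
  rw [Polynomial.sum_monomial_index]
  · simp [mulP, Wd, Module.End.pow_apply]
  · ext; simp [mulP]

/-- The composition of symbols, truncated at order `K`. -/
noncomputable def starProd (K : ℕ) (P Q : ℂ[X][X]) : ℂ[X][X] :=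
  ∑ k ∈ Finset.range K, hasseDeriv k P * derivX^[k] Q

theorem symbolOp_mul_monomial {K j : ℕ} (hj : j < K) (a : ℂ[X]) (Q : ℂ[X][X]) :
    symbolOp (monomial j a) * symbolOp Q = symbolOp (starProd K (monomial j a) Q) := by
  induction Q using Polynomial.induction_on' with
  | add P Q hP hQ =>
    rw [map_add, mul_add, hP, hQ, ← map_add]
    simp [starProd, iterate_map_add, mul_add, Finset.sum_add_distrib]
  | monomial l b =>
    apply LinearMap.ext
    intro f
    simp only [starProd, map_sum, LinearMap.sum_apply, Module.End.mul_apply,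
      symbolOp_monomial_apply, iterate_derivX_monomial, hasseDeriv_monomial, monomial_mul_monomial]
    rw [mul_comm b, iterate_derivative_mul, Finset.mul_sum]
    refine Finset.sum_subset_zero_on_sdiff ?_ ?_ ?_
    · intro k hk; simp at hk ⊢; omega
    · intro k hk
      simp at hk
      rw [Nat.choose_eq_zero_of_lt (by omega)]
      simp
    · intro k hk
      rw [Function.iterate_add_apply]
      simp only [nsmul_eq_mul]
      ring

theorem symbolOp_mul {K : ℕ} (P Q : ℂ[X][X]) (hP : P.natDegree < K) :
    symbolOp P * symbolOp Q = symbolOp (starProd K P Q) := by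
  have add_left (Q : ℂ[X][X]) : ∀ (s : Finset ℕ) (p : ℕ → ℂ[X][X]),
      starProd K (∑ i ∈ s, p i) Q = ∑ i ∈ s, starProd K (p i) Q := by
    intro s p
    simp only [starProd, map_sum, Finset.sum_mul]
    exact Finset.sum_comm
  rw [P.as_sum_range' K hP, add_left, map_sum, map_sum, Finset.sum_mul]
  exact Finset.sum_congr rfl fun j hj => symbolOp_mul_monomial (Finset.mem_range.1 hj) _ _

theorem symbolOp_apply (P : ℂ[X][X]) (f : ℂ[X]) :
    symbolOp P f = ∑ j ∈ Finset.range (P.natDegree + 1), P.coeff j * derivative^[j] f := by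
  conv_lhs => rw [P.as_sum_range]
  simp [map_sum, symbolOp_monomial_apply]

theorem symbolOp_injective : Function.Injective symbolOp := by
  rw [injective_iff_map_eq_zero]
  intro P hP
  ext1 j
  rw [coeff_zero]
  induction j using Nat.strong_induction_on with
  | _ j ih =>
    by_cases hj : P.natDegree < j
    · exact coeff_eq_zero_of_natDegree_lt hj
    have h := symbolOp_apply P (X ^ j)
    rw [hP, Finset.sum_eq_single j] at h
    · have h2 : (derivative^[j] (X ^ j : ℂ[X])) ≠ 0 := by
        rw [iterate_derivative_X_pow_eq_natCast_mul]
        simp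
      simpa [h2] using h.symm
    · intro l _ hl
      rcases lt_or_gt_of_ne hl with hl | hl
      · rw [ih l hl, zero_mul]
      · rw [iterate_derivative_eq_zero (by simpa using hl), mul_zero]
    · intro h; simp at h; omega

/-- The substitution `x ↦ T^q`, `ξ ↦ ξ T^p`, with values in `ℂ[ξ][T]`. -/
noncomputable def weightHom (p q : ℕ) : ℂ[X][X] →+* ℂ[X][X] :=
  eval₂RingHom (eval₂RingHom (C.comp C) (X ^ q)) (C X * X ^ p)

theorem weightHom_monomial (p q j i : ℕ) (c : ℂ) :
    weightHom p q (monomial j (monomial i c)) = monomial (q * i + p * j) (monomial j c) := by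
  simp only [weightHom, coe_eval₂RingHom, eval₂_monomial, RingHom.comp_apply]
  simp only [← C_mul_X_pow_eq_monomial, C_mul, C_pow]
  ring

theorem coeff_weightHom (p q : ℕ) (P : ℂ[X][X]) (n j : ℕ) :
    ((weightHom p q P).coeff n).coeff j = (X ^ (p * j) * expand ℂ q (P.coeff j)).coeff n := by
  induction P using bivariate_induction with
  | add P Q hP hQ => simp [mul_add, hP, hQ]
  | monomial l i c =>
    rw [weightHom_monomial, coeff_monomial, coeff_monomial]
    by_cases h : l = j
    · subst h
      rw [if_pos rfl, expand_monomial, X_pow_mul_monomial, coeff_monomial]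
      rw [mul_comm i q]
      split_ifs <;> simp
    · rw [if_neg h]
      split_ifs <;> simp [coeff_monomial, h]

theorem weightHom_injective (p : ℕ) {q : ℕ} (hq : 0 < q) :
    Function.Injective (weightHom p q) := by
  rw [injective_iff_map_eq_zero]
  intro P hP
  ext1 j
  have h : X ^ (p * j) * expand ℂ q (P.coeff j) = 0 := by
    ext n
    rw [← coeff_weightHom p q P n j, hP]; simp
  simpa [expand_eq_zero hq] using h

theorem coeff_weightHom_derivative (p q : ℕ) (P : ℂ[X][X]) (n : ℕ) :
    (X ^ p * weightHom p q (derivative P)).coeff n = derivative ((weightHom p q P).coeff n) := by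
  induction P using bivariate_induction with
  | add P Q hP hQ => simp only [map_add, mul_add, coeff_add, hP, hQ]
  | monomial j i c =>
    rcases j with _ | j
    · rw [weightHom_monomial, coeff_monomial]
      split_ifs <;> simp
    · rw [derivative_monomial, ← C_eq_natCast, monomial_mul_C, Nat.add_sub_cancel,
        weightHom_monomial, weightHom_monomial, X_pow_mul_monomial,
        coeff_monomial, coeff_monomial, show q * i + p * j + p = q * i + p * (j + 1) by ring]
      split_ifs <;> simp

theorem coeff_weightHom_derivX (p q : ℕ) (P : ℂ[X][X]) (n : ℕ) :
    (q : ℂ[X]) * (X ^ q * weightHom p q (derivX P)).coeff n =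
      (n : ℂ[X]) * (weightHom p q P).coeff n - (p : ℂ[X]) * (X * derivative ((weightHom p q P).coeff n)) := by
  induction P using bivariate_induction with
  | add P Q hP hQ => simp only [map_add, mul_add, coeff_add, hP, hQ]; ring
  | monomial j i c =>
    have hj : X * derivative (monomial j c) = C (j : ℂ) * monomial j c := by
      rcases j with _ | j
      · simp
      · rw [derivative_monomial, X_mul_monomial, C_mul_monomial]
        simp [mul_comm]
    rcases i with _ | i
    · rw [derivX_monomial, weightHom_monomial, coeff_monomial]
      split_ifs with h
      · rw [hj, ← h]; simp; ring
      · simp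
    · rw [derivX_monomial, derivative_monomial, weightHom_monomial, weightHom_monomial,
        X_pow_mul_monomial, coeff_monomial, coeff_monomial, Nat.add_sub_cancel,
        show q * i + p * j + q = q * (i + 1) + p * j by ring]
      split_ifs with h
      · rw [hj, ← h, mul_comm c, ← C_mul_monomial]
        simp
        ring
      · simp

theorem degree_weightHom_derivative (p q : ℕ) (P : ℂ[X][X]) :
    (weightHom p q (derivative P)).degree + p ≤ (weightHom p q P).degree := by
  have h : (X ^ p * weightHom p q (derivative P)).degree ≤ (weightHom p q P).degree := by
    rw [degree_le_iff_coeff_zero]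
    intro n hn
    rw [coeff_weightHom_derivative, coeff_eq_zero_of_degree_lt hn, derivative_zero]
  rwa [degree_mul, degree_X_pow, add_comm] at h

theorem degree_weightHom_derivX (p : ℕ) {q : ℕ} (hq : 0 < q) (P : ℂ[X][X]) :
    (weightHom p q (derivX P)).degree + q ≤ (weightHom p q P).degree := by
  have h : (X ^ q * weightHom p q (derivX P)).degree ≤ (weightHom p q P).degree := by
    rw [degree_le_iff_coeff_zero]
    intro n hn
    have h := coeff_weightHom_derivX p q P n
    rw [coeff_eq_zero_of_degree_lt hn, derivative_zero, mul_zero, mul_zero, mul_zero, sub_zero,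
      mul_eq_zero] at h
    exact h.resolve_left (by exact_mod_cast hq.ne')
  rwa [degree_mul, degree_X_pow, add_comm] at h

theorem degree_weightHom_iterate {p q r : ℕ} {D : ℂ[X][X] → ℂ[X][X]}
    (hD : ∀ P, (weightHom p q (D P)).degree + r ≤ (weightHom p q P).degree)
    (k : ℕ) (P : ℂ[X][X]) :
    (weightHom p q (D^[k] P)).degree + (k * r : ℕ) ≤ (weightHom p q P).degree := by
  induction k with
  | zero => simp
  | succ k ih =>
    rw [Function.iterate_succ_apply']
    refine le_trans ?_ ih
    rw [add_mul, one_mul, add_comm (k * r), Nat.cast_add, ← add_assoc]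
    exact add_le_add_left (hD _) _

theorem degree_weightHom_hasseDeriv (p q k : ℕ) (P : ℂ[X][X]) :
    (weightHom p q (hasseDeriv k P)).degree + (k * p : ℕ) ≤ (weightHom p q P).degree := by
  have h := degree_weightHom_iterate (degree_weightHom_derivative p q) k P
  rw [← factorial_smul_hasseDeriv, LinearMap.smul_apply, map_nsmul, nsmul_eq_mul, degree_mul,
    ← C_eq_natCast, degree_C (by exact_mod_cast k.factorial_ne_zero), zero_add] at h
  exact h

theorem coeff_weightHom_starProd_term {p q : ℕ} (hq : 0 < q) {P Q : ℂ[X][X]} {a b k : ℕ}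
    (hP : (weightHom p q P).natDegree ≤ a) (hQ : (weightHom p q Q).natDegree ≤ b) (hk : 2 ≤ k) :
    (X ^ (p + q) * weightHom p q (hasseDeriv k P * derivX^[k] Q)).coeff (a + b) = 0 := by
  have h1 := (degree_weightHom_hasseDeriv p q k P).trans (natDegree_le_iff_degree_le.1 hP)
  have h2 := (degree_weightHom_iterate (degree_weightHom_derivX p hq) k Q).trans
    (natDegree_le_iff_degree_le.1 hQ)
  rw [map_mul]
  by_cases hA : weightHom p q (hasseDeriv k P) = 0
  · simp [hA]
  by_cases hB : weightHom p q (derivX^[k] Q) = 0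
  · simp [hB]
  rw [degree_eq_natDegree hA] at h1
  rw [degree_eq_natDegree hB] at h2
  norm_cast at h1 h2
  apply coeff_eq_zero_of_natDegree_lt
  rw [natDegree_mul (by simp) (mul_ne_zero hA hB), natDegree_mul hA hB, natDegree_X_pow]
  have : 2 * (p + q) ≤ k * (p + q) := Nat.mul_le_mul_right _ hk
  linarith

/-- The leading forms of two commuting operators Poisson commute; in view of Euler's identity this
is a differential equation for their restrictions to `x = 1`. -/
theorem leadingForm_commute {p q : ℕ} (hq : 0 < q) {P Q : ℂ[X][X]} {a b : ℕ}
    (hP : (weightHom p q P).natDegree ≤ a) (hQ : (weightHom p q Q).natDegree ≤ b)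
    (hcomm : symbolOp P * symbolOp Q = symbolOp Q * symbolOp P) :
    (a : ℂ[X]) * (weightHom p q P).coeff a * derivative ((weightHom p q Q).coeff b) =
      (b : ℂ[X]) * derivative ((weightHom p q P).coeff a) * (weightHom p q Q).coeff b := by
  set K := P.natDegree + Q.natDegree
  rw [symbolOp_mul (K := K + 1 + 1) P Q (by omega), symbolOp_mul (K := K + 1 + 1) Q P (by omega)]
    at hcomm
  replace hcomm := congrArg (fun S => (X ^ (p + q) * weightHom p q S).coeff (a + b))
    (symbolOp_injective hcomm)
  simp only [starProd, Finset.sum_range_succ', map_add, map_sum, mul_add, Finset.mul_sum,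
    coeff_add, finsetSum_coeff] at hcomm
  rw [Finset.sum_eq_zero fun k _ => coeff_weightHom_starProd_term hq hP hQ (by omega),
    Finset.sum_eq_zero fun k _ => by
      rw [add_comm a b]; exact coeff_weightHom_starProd_term hq hQ hP (by omega)] at hcomm
  simp only [zero_add, hasseDeriv_one, hasseDeriv_zero, Function.iterate_one,
    Function.iterate_zero, id_eq, LinearMap.id_apply, mul_comm Q P, add_left_inj] at hcomm
  have key {P Q : ℂ[X][X]} {a b : ℕ} (hP : (weightHom p q P).natDegree ≤ a)
      (hQ : (weightHom p q Q).natDegree ≤ b) :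
      (X ^ (p + q) * weightHom p q (derivative P * derivX Q)).coeff (a + b) =
        derivative ((weightHom p q P).coeff a) * (X ^ q * weightHom p q (derivX Q)).coeff b := by
    rw [map_mul, pow_add, mul_mul_mul_comm, coeff_mul_add_eq_of_natDegree_le,
      coeff_weightHom_derivative]
    · have := degree_weightHom_derivative p q P
      rw [natDegree_le_iff_degree_le, degree_mul, degree_X_pow, add_comm]
      exact this.trans (natDegree_le_iff_degree_le.1 hP)
    · have := degree_weightHom_derivX p hq Q
      rw [natDegree_le_iff_degree_le, degree_mul, degree_X_pow, add_comm]
      exact this.trans (natDegree_le_iff_degree_le.1 hQ)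
  rw [key hP hQ, add_comm a b, key hQ hP] at hcomm
  have hP' := coeff_weightHom_derivX p q P a
  have hQ' := coeff_weightHom_derivX p q Q b
  linear_combination (-q : ℂ[X]) * hcomm + derivative ((weightHom p q P).coeff a) * hQ' -
    derivative ((weightHom p q Q).coeff b) * hP'

/-- A monic quartic without cubic term is `X ^ 4` as soon as an odd power of it is, up to a
constant, a fourth power; the latter is expressed through logarithmic derivatives. -/
theorem eq_X_pow_of_odd {F G : ℂ[X]} (hF : F.Monic) (hF4 : F.natDegree = 4) (hF3 : F.coeff 3 = 0)
    (hG : G ≠ 0) {m : ℕ} (hm : Odd m)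
    (h : 4 * F * derivative G = (m : ℂ[X]) * derivative F * G) : F = X ^ 4 := by
  obtain ⟨r, hr⟩ := IsAlgClosed.exists_root F (by
    rw [degree_eq_natDegree hF.ne_zero, hF4]; norm_num)
  obtain ⟨A, hA, hA'⟩ := exists_eq_pow_rootMultiplicity_mul_and_not_dvd F hF.ne_zero r
  obtain ⟨B, hB, hB'⟩ := exists_eq_pow_rootMultiplicity_mul_and_not_dvd G hG r
  have hpos := (rootMultiplicity_pos hF.ne_zero).2 hr
  set μ := F.rootMultiplicity r
  set ν := G.rootMultiplicity r
  have hder (k : ℕ) (E : ℂ[X]) : (X - C r) * derivative ((X - C r) ^ k * E) =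
      (X - C r) ^ k * ((k : ℂ[X]) * E + (X - C r) * derivative E) := by
    rcases k with _ | k
    · simp
    · simp only [derivative_mul, derivative_X_sub_C_pow, Nat.add_sub_cancel, C_eq_natCast]
      ring
  have h1 : (X - C r) ^ (μ + ν) * (4 * A * ((ν : ℂ[X]) * B + (X - C r) * derivative B)) =
      (X - C r) ^ (μ + ν) * ((m : ℂ[X]) * B * ((μ : ℂ[X]) * A + (X - C r) * derivative A)) := by
    have e1 := hder μ A
    have e2 := hder ν B
    rw [← hA] at e1
    rw [← hB] at e2
    rw [pow_add]
    linear_combination (X - C r) * h - 4 * F * e2 + m * G * e1 -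
      4 * (X - C r) ^ ν * ((ν : ℂ[X]) * B + (X - C r) * derivative B) * hA +
      (m : ℂ[X]) * (X - C r) ^ μ * ((μ : ℂ[X]) * A + (X - C r) * derivative A) * hB
  replace h1 := mul_left_cancel₀ (pow_ne_zero _ (X_sub_C_ne_zero r)) h1
  replace h1 := congrArg (eval r) h1
  rw [dvd_iff_isRoot, IsRoot.def] at hA' hB'
  simp at h1
  have h2 : (4 * ν : ℂ) = m * μ :=
    mul_right_cancel₀ (mul_ne_zero hA' hB') (by linear_combination h1)
  have h3 : 4 * ν = m * μ := by exact_mod_cast h2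
  have h4 : 4 ∣ μ := by
    refine Nat.Coprime.dvd_of_dvd_mul_left ?_ (Dvd.intro _ h3)
    exact Nat.Coprime.pow_left 2 (Nat.coprime_two_left.2 hm)
  have hA0 : A ≠ 0 := by rintro rfl; simp at hA'
  have h5 : μ + A.natDegree = 4 := by
    rw [← hF4]
    conv_rhs => rw [hA]
    rw [natDegree_mul (pow_ne_zero _ (X_sub_C_ne_zero r)) hA0]
    simp
  have h6 : μ = 4 := by
    have := Nat.le_of_dvd hpos h4
    omega
  have hA1 : A = 1 := by
    have hAm : A.Monic := by
      rw [hA] at hF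
      exact ((monic_X_sub_C r).pow μ).of_mul_monic_left hF
    exact hAm.natDegree_eq_zero.1 (by omega)
  rw [hA1, mul_one, h6] at hA
  rw [hA, sub_eq_add_neg, ← C_neg, coeff_X_add_C_pow] at hF3
  norm_num at hF3
  rw [hA, hF3]; simp

theorem coeff_coeff_weightHom (p : ℕ) {q : ℕ} (hq : 0 < q) (P : ℂ[X][X]) (j d : ℕ) :
    ((weightHom p q P).coeff (d * q + p * j)).coeff j = (P.coeff j).coeff d := by
  rw [coeff_weightHom, coeff_X_pow_mul, coeff_expand_mul hq]

theorem natDegree_weightHom_le {p q n : ℕ} {P : ℂ[X][X]}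
    (h : ∀ j, P.coeff j ≠ 0 → p * j + (P.coeff j).natDegree * q ≤ n) :
    (weightHom p q P).natDegree ≤ n := by
  rw [natDegree_le_iff_coeff_eq_zero]
  intro N hN
  ext j
  rw [coeff_weightHom, coeff_zero]
  by_cases hj : P.coeff j = 0
  · simp [hj]
  · apply coeff_eq_zero_of_natDegree_lt
    refine natDegree_mul_le.trans_lt ?_
    rw [natDegree_X_pow, natDegree_expand]
    exact (h j hj).trans_lt hN

/-- The symbol of `∂⁴ + a₂ ∂² + a₁ ∂ + a₀`. -/
noncomputable def quarticSymbol (a₀ a₁ a₂ : ℂ[X]) : ℂ[X][X] :=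
  monomial 4 1 + monomial 2 a₂ + monomial 1 a₁ + monomial 0 a₀

/-- An operator commuting with a non-constant operator `∂⁴ + a₂ ∂² + a₁ ∂ + a₀` has even order. -/
theorem even_natDegree_of_commute {a₀ a₁ a₂ : ℂ[X]} {Q : ℂ[X][X]} (hQ : Q ≠ 0)
    (ha : ¬ (a₀.natDegree = 0 ∧ a₁.natDegree = 0 ∧ a₂.natDegree = 0))
    (hcomm : symbolOp (quarticSymbol a₀ a₁ a₂) * symbolOp Q =
      symbolOp Q * symbolOp (quarticSymbol a₀ a₁ a₂)) : Even Q.natDegree := by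
  by_contra hodd
  rw [Nat.not_even_iff_odd] at hodd
  set P := quarticSymbol a₀ a₁ a₂ with hPdef
  -- the weights of `x` and `ξ`, chosen so that the leading form of `P` is not `ξ⁴`
  obtain ⟨q, hq12⟩ : ∃ q, q = 12 := ⟨_, rfl⟩
  have hq : 0 < q := by omega
  obtain ⟨p, hp⟩ : ∃ p, p = max (3 * a₀.natDegree) (max (4 * a₁.natDegree) (6 * a₂.natDegree)) :=
    ⟨_, rfl⟩
  have hp0 : 0 < p := by omega
  have c0 : P.coeff 0 = a₀ := by simp [hPdef, quarticSymbol, coeff_monomial]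
  have c1 : P.coeff 1 = a₁ := by simp [hPdef, quarticSymbol, coeff_monomial]
  have c2 : P.coeff 2 = a₂ := by simp [hPdef, quarticSymbol, coeff_monomial]
  have c3 : P.coeff 3 = 0 := by simp [hPdef, quarticSymbol, coeff_monomial]
  have c4 : P.coeff 4 = 1 := by simp [hPdef, quarticSymbol, coeff_monomial]
  have c5 (j : ℕ) (hj : 4 < j) : P.coeff j = 0 := by
    simp only [hPdef, quarticSymbol, coeff_add, coeff_monomial]
    rw [if_neg (by omega), if_neg (by omega), if_neg (by omega), if_neg (by omega)]
    simp
  have hP : (weightHom p q P).natDegree ≤ 4 * p := by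
    apply natDegree_weightHom_le
    intro j hj
    have hj4 : j ≤ 4 := by
      by_contra hj'
      exact hj (c5 j (by omega))
    interval_cases j
    · rw [c0, hq12]; omega
    · rw [c1, hq12]; omega
    · rw [c2, hq12]; omega
    · exact absurd c3 hj
    · rw [c4, natDegree_one]; omega
  have hcoeff (j d : ℕ) (h : 4 * p = d * q + p * j) :
      ((weightHom p q P).coeff (4 * p)).coeff j = (P.coeff j).coeff d := by
    rw [h, coeff_coeff_weightHom p hq]
  have hzero (j : ℕ) (hj : P.coeff j = 0) : ((weightHom p q P).coeff (4 * p)).coeff j = 0 := by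
    rw [coeff_weightHom, hj]; simp
  have hF4 : ((weightHom p q P).coeff (4 * p)).coeff 4 = 1 := by
    rw [hcoeff 4 0 (by ring), c4, coeff_one_zero]
  have hF3 := hzero 3 c3
  have hFle : ((weightHom p q P).coeff (4 * p)).natDegree ≤ 4 :=
    natDegree_le_iff_coeff_eq_zero.2 fun j hj => hzero j (c5 j hj)
  have hlead {a : ℂ[X]} {j r : ℕ} (hj : P.coeff j = a) (hr : p = r * a.natDegree)
      (hj4 : 4 * r = 12 + r * j) : ((weightHom p q P).coeff (4 * p)).coeff j ≠ 0 := by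
    rw [hcoeff j a.natDegree (by rw [hr, hq12]; linear_combination a.natDegree * hj4), hj]
    apply leadingCoeff_ne_zero.2
    rintro rfl
    simp at hr
    omega
  have hFne : (weightHom p q P).coeff (4 * p) ≠ X ^ 4 := by
    intro h
    have h0 : p = 3 * a₀.natDegree ∨ p = 4 * a₁.natDegree ∨ p = 6 * a₂.natDegree := by omega
    rcases h0 with h0 | h0 | h0
    · exact hlead c0 h0 (by norm_num) (by rw [h]; simp [coeff_X_pow])
    · exact hlead c1 h0 (by norm_num) (by rw [h]; simp [coeff_X_pow])
    · exact hlead c2 h0 (by norm_num) (by rw [h]; simp [coeff_X_pow])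
  set F := (weightHom p q P).coeff (4 * p)
  have hFdeg : F.natDegree = 4 :=
    le_antisymm hFle (le_natDegree_of_ne_zero (by rw [hF4]; exact one_ne_zero))
  have hFm : F.Monic := by rw [Monic, leadingCoeff, hFdeg, hF4]
  have hΦQ : weightHom p q Q ≠ 0 := (map_ne_zero_iff _ (weightHom_injective p hq)).2 hQ
  have hode := leadingForm_commute hq hP le_rfl hcomm
  obtain ⟨N, hN⟩ : ∃ N, N = (weightHom p q Q).natDegree := ⟨_, rfl⟩
  have hG : (weightHom p q Q).coeff N ≠ 0 := by
    rw [hN]; exact leadingCoeff_ne_zero.2 hΦQ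
  have hGle : ((weightHom p q Q).coeff N).natDegree ≤ Q.natDegree := by
    refine natDegree_le_iff_coeff_eq_zero.2 fun j hj => ?_
    rw [coeff_weightHom, coeff_eq_zero_of_natDegree_lt hj]; simp
  have hNge : p * Q.natDegree ≤ N := by
    have h : (weightHom p q Q).coeff
        ((Q.coeff Q.natDegree).natDegree * q + p * Q.natDegree) ≠ 0 := by
      intro h
      have h2 := coeff_coeff_weightHom p hq Q Q.natDegree (Q.coeff Q.natDegree).natDegree
      rw [h, coeff_zero] at h2
      exact leadingCoeff_ne_zero.2 (leadingCoeff_ne_zero.2 hQ) h2.symm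
    have := le_natDegree_of_ne_zero h
    omega
  rw [← hN] at hode
  set G := (weightHom p q Q).coeff N
  have hXder (E : ℂ[X]) (k : ℕ) : (X * derivative E).coeff k = k * E.coeff k := by
    rcases k with _ | k
    · simp
    · rw [coeff_X_mul, coeff_derivative]; push_cast; ring
  have hXderle (E : ℂ[X]) : (X * derivative E).natDegree ≤ E.natDegree :=
    natDegree_le_iff_coeff_eq_zero.2 fun k hk => by
      rw [hXder, coeff_eq_zero_of_natDegree_lt hk, mul_zero]
  have hNeq : N = p * G.natDegree := by
    have h : C ((4 * p : ℕ) : ℂ) * (F * (X * derivative G)) =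
        C (N : ℂ) * ((X * derivative F) * G) := by
      rw [C_eq_natCast, C_eq_natCast]
      linear_combination X * hode
    replace h := congrArg (fun E => E.coeff (4 + G.natDegree)) h
    simp only [coeff_C_mul] at h
    rw [coeff_mul_add_eq_of_natDegree_le hFle (hXderle G),
      coeff_mul_add_eq_of_natDegree_le ((hXderle F).trans hFle) le_rfl, hXder, hXder, hF4] at h
    have hlc : G.coeff G.natDegree ≠ 0 := leadingCoeff_ne_zero.2 hG
    have h2 : (N : ℂ) = p * G.natDegree := by
      apply mul_right_cancel₀ hlc
      push_cast at h
      linear_combination (-1 / 4 : ℂ) * h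
    exact_mod_cast h2
  have hGdeg : G.natDegree = Q.natDegree :=
    le_antisymm hGle (Nat.le_of_mul_le_mul_left (hNge.trans hNeq.le) hp0)
  refine hFne (eq_X_pow_of_odd hFm hFdeg hF3 hG hodd ?_)
  rw [hNeq, hGdeg] at hode
  have hp' : (p : ℂ[X]) ≠ 0 := by exact_mod_cast hp0.ne'
  apply mul_left_cancel₀ hp'
  push_cast at hode
  linear_combination hode

/-- The symbol of `toOp c`. -/
noncomputable def finsuppSymbol (c : (ℕ × ℕ) →₀ ℂ) : ℂ[X][X] :=
  c.sum fun ij z => monomial ij.2 (monomial ij.1 z)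

theorem symbolOp_finsuppSymbol (c : (ℕ × ℕ) →₀ ℂ) : symbolOp (finsuppSymbol c) = toOp c := by
  rw [finsuppSymbol, toOp, Finsupp.sum, Finsupp.sum, map_sum]
  refine Finset.sum_congr rfl fun ij _ => LinearMap.ext fun f => ?_
  have hx (i : ℕ) (g : ℂ[X]) : (Wx ^ i) g = X ^ i * g := by
    rw [Wx, LinearMap.pow_mulLeft, LinearMap.mulLeft_apply]
  rw [symbolOp_monomial_apply, LinearMap.smul_apply, Module.End.mul_apply, hx,
    Module.End.pow_apply, ← C_mul_X_pow_eq_monomial, smul_eq_C_mul, mul_assoc]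
  rfl

theorem coeff_finsuppSymbol (c : (ℕ × ℕ) →₀ ℂ) (i j : ℕ) :
    ((finsuppSymbol c).coeff j).coeff i = c (i, j) := by
  rw [finsuppSymbol, Finsupp.sum, finsetSum_coeff, finsetSum_coeff, Finset.sum_eq_single (i, j)]
  · simp
  · rintro ⟨k, l⟩ _ hne
    by_cases hl : l = j
    · subst hl
      simp only [coeff_monomial_same, coeff_monomial]
      exact if_neg fun h => hne (by rw [h])
    · simp [coeff_monomial, hl]
  · intro h
    simpa using h

theorem natDegree_finsuppSymbol (c : (ℕ × ℕ) →₀ ℂ) :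
    (finsuppSymbol c).natDegree = c.support.sup fun ij => ij.2 := by
  apply le_antisymm
  · refine natDegree_le_iff_coeff_eq_zero.2 fun j hj => ?_
    ext i
    rw [coeff_finsuppSymbol, coeff_zero]
    by_contra h
    have := Finset.le_sup (f := fun ij : ℕ × ℕ => ij.2) (Finsupp.mem_support_iff.2 h)
    exact absurd hj (not_lt.2 this)
  · refine Finset.sup_le fun ij hij => le_natDegree_of_ne_zero fun h => ?_
    have h2 := coeff_finsuppSymbol c ij.1 ij.2
    rw [h, coeff_zero] at h2
    exact Finsupp.mem_support_iff.1 hij h2.symm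

theorem symbolOp_quarticSymbol (U V W : ℂ[X]) :
    symbolOp (quarticSymbol (derivative (derivative V) + V * V + W) (2 * derivative V + U) (2 * V))
      = (Wd ^ 2 + mulP V) ^ 2 + mulP U * Wd + mulP W := by
  apply LinearMap.ext
  intro f
  simp only [quarticSymbol, map_add, LinearMap.add_apply, symbolOp_monomial_apply]
  simp [sq, mulP, Wd]
  ring

theorem ordW_sq_add_mulP_C (v : ℂ) : OrdW (Wd ^ 2 + mulP (C v)) 2 := by
  have hsymbol : finsuppSymbol (Finsupp.single (0, 2) 1 + Finsupp.single (0, 0) v) =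
      monomial 2 1 + monomial 0 (C v) := by
    rw [finsuppSymbol, Finsupp.sum_add_index' (by simp) (by simp),
      Finsupp.sum_single_index (by simp), Finsupp.sum_single_index (by simp)]
    simp
  refine ⟨Finsupp.single (0, 2) 1 + Finsupp.single (0, 0) v, ?_, ?_, ?_⟩
  · rw [← symbolOp_finsuppSymbol, hsymbol]
    apply LinearMap.ext
    intro f
    simp only [map_add, LinearMap.add_apply, symbolOp_monomial_apply]
    simp [mulP, Wd, Module.End.pow_apply]
  · intro h
    simpa using DFunLike.congr_fun h (0, 2)
  · rw [← natDegree_finsuppSymbol, hsymbol]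
    simp only [monomial_zero_left, natDegree_add_C]
    exact (natDegree_monomial_eq 2 one_ne_zero).symm

/-- Let `L₄ = (∂² + V)² + U ∂ + W` be an irreducible operator of order 4
in `A₁(ℂ)` with `U, V, W ∈ ℂ[x]` and `deg V > max{deg U / 2, deg W / 2}` (equivalently
`deg U < deg V² and deg W < deg V²`).  Then every nonzero operator in `A₁(ℂ)` commuting
with `L₄` has even order. -/
theorem statement15 (U V W : Polynomial ℂ)
    (L4 : Module.End ℂ (Polynomial ℂ))
    (hL4 : L4 = (Wd ^ 2 + mulP V) ^ 2 + mulP U * Wd + mulP W)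
    (hirr : IrreducibleOp L4)
    (hdegU : U.degree < (V * V).degree) (hdegW : W.degree < (V * V).degree) :
    ∀ M : Module.End ℂ (Polynomial ℂ), M ≠ 0 → InWeyl M → M * L4 = L4 * M →
      ∀ k, OrdW M k → Even k := by
  subst hL4
  rintro M - - hML k ⟨c, rfl, hc, rfl⟩
  rw [← symbolOp_finsuppSymbol, ← symbolOp_quarticSymbol] at hML
  rw [← natDegree_finsuppSymbol]
  refine even_natDegree_of_commute ?_ ?_ hML.symm
  · rintro h
    apply hc
    ext ⟨i, j⟩
    rw [← coeff_finsuppSymbol, h]; simp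
  · rintro ⟨-, -, hV⟩
    rw [show (2 : ℂ[X]) * V = C 2 * V from rfl, natDegree_C_mul two_ne_zero] at hV
    obtain ⟨v, rfl⟩ := natDegree_eq_zero.1 hV
    have hlt (R : ℂ[X]) (hR : R.degree < (C v * C v).degree) : R = 0 := by
      rw [← C_mul] at hR
      exact degree_eq_bot.1 (Nat.WithBot.lt_zero_iff.1 (hR.trans_le degree_C_le))
    rw [hlt U hdegU, hlt W hdegW] at hirr
    obtain ⟨d, hd, -⟩ := ordW_sq_add_mulP_C v
    refine hirr ⟨_, _, ⟨d, hd⟩, ⟨d, hd⟩, ⟨2, two_pos, ordW_sq_add_mulP_C v⟩,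
      ⟨2, two_pos, ordW_sq_add_mulP_C v⟩, ?_⟩
    apply LinearMap.ext
    intro f
    simp [mulP, sq]
end

section
/- Let L₄ = (∂² + V(x))² + U(x)∂ + W(x) be an irreducible operator of order 4 in A₁(ℂ), with U, V, W ∈ ℂ[x]. If the centralizer 𝒞(L₄) is strictly larger than ℂ[L₄], then deg(V) > max{(1/2)deg(U), (1/2)deg(W)}. -/
open scoped BigOperators

open Polynomial

/-- The monomial `x^i ∂^j`. -/
noncomputable def weylMonomial (a : ℕ × ℕ) : Module.End ℂ ℂ[X] := Wx ^ a.1 * Wd ^ a.2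

theorem toOp_eq_linearCombination (c : (ℕ × ℕ) →₀ ℂ) :
    toOp c = Finsupp.linearCombination ℂ weylMonomial c := rfl

theorem Wx_pow_apply (k : ℕ) (f : ℂ[X]) : (Wx ^ k) f = X ^ k * f := by
  induction k with
  | zero => simp
  | succ k ih => rw [pow_succ', Module.End.mul_apply, ih, Wx, LinearMap.mulLeft_apply]; ring

theorem Wd_pow_apply (k : ℕ) (f : ℂ[X]) : (Wd ^ k) f = derivative^[k] f := by
  rw [Module.End.pow_apply, Wd]

theorem toOp_injective : Function.Injective toOp := by
  have key : ∀ c : (ℕ × ℕ) →₀ ℂ, toOp c = 0 → ∀ j i, c (i, j) = 0 := by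
    intro c hc j
    induction j using Nat.strong_induction_on with
    | _ j ih =>
      intro i
      have h : (toOp c (X ^ j)).coeff i = 0 := by rw [hc]; simp
      have hterm : ∀ a ∈ c.support, a ≠ (i, j) →
          ((c a • (Wx ^ a.1 * Wd ^ a.2)) (X ^ j) : ℂ[X]).coeff i = 0 := by
        rintro ⟨k, l⟩ ha hne
        rw [LinearMap.smul_apply, Module.End.mul_apply, Wx_pow_apply, Wd_pow_apply]
        rcases lt_trichotomy l j with hl | rfl | hl
        · exact absurd (ih l hl k) (Finsupp.mem_support_iff.1 ha)
        · have hki : i ≠ k := fun h => hne (by rw [h])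
          simp [iterate_derivative_X_pow_eq_smul, coeff_X_pow, hki]
        · simp [iterate_derivative_X_pow_eq_smul, Nat.descFactorial_of_lt hl]
      rw [toOp, Finsupp.sum, LinearMap.sum_apply, finsetSum_coeff,
        Finset.sum_eq_single (i, j) hterm (by simp +contextual)] at h
      rw [LinearMap.smul_apply, Module.End.mul_apply, Wx_pow_apply, Wd_pow_apply] at h
      simpa [iterate_derivative_X_pow_eq_smul, Nat.descFactorial_self, Nat.factorial_ne_zero]
        using h
  intro c d h
  have h0 : toOp (c - d) = 0 := by
    simp only [toOp_eq_linearCombination] at h ⊢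
    rw [map_sub, h, sub_self]
  ext ⟨i, j⟩
  simpa [sub_eq_zero] using key _ h0 j i

theorem Wd_pow_mul_Wx_pow (j k : ℕ) :
    Wd ^ j * Wx ^ k = ∑ r ∈ Finset.range (j + 1),
      ((j.choose r * k.descFactorial r : ℕ) : ℂ) • (Wx ^ (k - r) * Wd ^ (j - r)) := by
  refine LinearMap.ext fun f => ?_
  rw [Module.End.mul_apply, Wx_pow_apply, Wd_pow_apply, mul_comm, iterate_derivative_mul,
    LinearMap.sum_apply]
  refine Finset.sum_congr rfl fun r _ => ?_
  rw [LinearMap.smul_apply, Module.End.mul_apply, Wx_pow_apply, Wd_pow_apply,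
    iterate_derivative_X_pow_eq_smul, Nat.cast_smul_eq_nsmul, mul_smul_comm, smul_smul,
    mul_comm (X ^ _), Nat.cast_smul_eq_nsmul]

/-- The normally ordered expansion of the product of two monomials of the Weyl algebra. -/
noncomputable def starMonomial (a b : ℕ × ℕ) : (ℕ × ℕ) →₀ ℂ :=
  ∑ r ∈ Finset.range (a.2 + 1),
    Finsupp.single (a.1 + (b.1 - r), a.2 - r + b.2) ((a.2.choose r * b.1.descFactorial r : ℕ) : ℂ)

/-- The multiplication of the Weyl algebra in terms of normally ordered coefficients. -/
noncomputable def weylStar :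
    ((ℕ × ℕ) →₀ ℂ) →ₗ[ℂ] ((ℕ × ℕ) →₀ ℂ) →ₗ[ℂ] ((ℕ × ℕ) →₀ ℂ) :=
  Finsupp.linearCombination ℂ fun a => Finsupp.linearCombination ℂ (starMonomial a)

theorem weylStar_single_one (a b : ℕ × ℕ) :
    weylStar (Finsupp.single a 1) (Finsupp.single b 1) = starMonomial a b := by
  simp [weylStar]

/-- The bilinear map `(c, d) ↦ f c * g d`. -/
noncomputable def mulBilinear {A : Type*} [Ring A] [Algebra ℂ A]
    (f g : ((ℕ × ℕ) →₀ ℂ) →ₗ[ℂ] A) : ((ℕ × ℕ) →₀ ℂ) →ₗ[ℂ] ((ℕ × ℕ) →₀ ℂ) →ₗ[ℂ] A :=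
  (LinearMap.mul ℂ A).compl₁₂ f g

theorem mulBilinear_apply {A : Type*} [Ring A] [Algebra ℂ A]
    (f g : ((ℕ × ℕ) →₀ ℂ) →ₗ[ℂ] A) (c d : (ℕ × ℕ) →₀ ℂ) :
    mulBilinear f g c d = f c * g d := rfl

theorem bilinear_eq_of_mem_supported {N : Type*} [AddCommGroup N] [Module ℂ N]
    (Φ Ψ : ((ℕ × ℕ) →₀ ℂ) →ₗ[ℂ] ((ℕ × ℕ) →₀ ℂ) →ₗ[ℂ] N) {s t : Set (ℕ × ℕ)}
    (h : ∀ a ∈ s, ∀ b ∈ t, Φ (Finsupp.single a 1) (Finsupp.single b 1) =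
      Ψ (Finsupp.single a 1) (Finsupp.single b 1))
    {c d : (ℕ × ℕ) →₀ ℂ} (hc : c ∈ Finsupp.supported ℂ ℂ s)
    (hd : d ∈ Finsupp.supported ℂ ℂ t) : Φ c d = Ψ c d := by
  rw [Finsupp.supported_eq_span_single] at hc hd
  refine LinearMap.eqOn_span (f := Φ.flip d) (g := Ψ.flip d) ?_ hc
  rintro _ ⟨a, ha, rfl⟩
  refine LinearMap.eqOn_span (f := Φ (Finsupp.single a 1)) (g := Ψ (Finsupp.single a 1)) ?_ hd
  rintro _ ⟨b, hb, rfl⟩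
  exact h a ha b hb

theorem toOp_starMonomial (a b : ℕ × ℕ) :
    toOp (starMonomial a b) = weylMonomial a * weylMonomial b := by
  have h : weylMonomial a * weylMonomial b = Wx ^ a.1 * (Wd ^ a.2 * Wx ^ b.1) * Wd ^ b.2 := by
    simp only [weylMonomial, mul_assoc]
  rw [h, Wd_pow_mul_Wx_pow, toOp_eq_linearCombination, starMonomial, map_sum, Finset.mul_sum,
    Finset.sum_mul]
  refine Finset.sum_congr rfl fun r _ => ?_
  rw [Finsupp.linearCombination_single, weylMonomial, mul_smul_comm, smul_mul_assoc, pow_add,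
    pow_add]
  simp only [mul_assoc]

theorem toOp_weylStar (c d : (ℕ × ℕ) →₀ ℂ) : toOp (weylStar c d) = toOp c * toOp d := by
  simp only [toOp_eq_linearCombination]
  have key := bilinear_eq_of_mem_supported (c := c) (d := d)
    (weylStar.compr₂ (Finsupp.linearCombination ℂ weylMonomial))
    (mulBilinear (Finsupp.linearCombination ℂ weylMonomial)
      (Finsupp.linearCombination ℂ weylMonomial)) (s := Set.univ) (t := Set.univ) ?_
    (by simp) (by simp)
  · exact key
  intro a _ b _
  simp [weylStar_single_one, mulBilinear_apply, ← toOp_eq_linearCombination, toOp_starMonomial]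

/-- The weight of the monomial `x^i ∂^j` when `x` has weight `q` and `∂` has weight `p`. -/
def weylWeight (q p : ℤ) (a : ℕ × ℕ) : ℤ := q * a.1 + p * a.2

/-- Coefficient families of weight at most `n`. -/
noncomputable def weightLE (q p n : ℤ) : Submodule ℂ ((ℕ × ℕ) →₀ ℂ) :=
  Finsupp.supported ℂ ℂ {a | weylWeight q p a ≤ n}

/-- The part of weight `n` of a coefficient family, with `x` set to `1`, as a polynomial in the
symbol of `∂`. -/
noncomputable def weylSymbol (q p n : ℤ) : ((ℕ × ℕ) →₀ ℂ) →ₗ[ℂ] ℂ[X] :=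
  Finsupp.linearCombination ℂ fun a => if weylWeight q p a = n then X ^ a.2 else 0

theorem weylSymbol_single (q p n : ℤ) (a : ℕ × ℕ) (z : ℂ) :
    weylSymbol q p n (Finsupp.single a z) =
      if weylWeight q p a = n then z • (X ^ a.2 : ℂ[X]) else 0 := by
  rw [weylSymbol, Finsupp.linearCombination_single, smul_ite, smul_zero]

theorem mem_weightLE {q p n : ℤ} {c : (ℕ × ℕ) →₀ ℂ} :
    c ∈ weightLE q p n ↔ ∀ a, n < weylWeight q p a → c a = 0 := by
  rw [weightLE, Finsupp.mem_supported']
  simp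

theorem coeff_weylSymbol {q p n : ℤ} (hq : 0 < q) (c : (ℕ × ℕ) →₀ ℂ) (a : ℕ × ℕ)
    (ha : weylWeight q p a = n) : (weylSymbol q p n c).coeff a.2 = c a := by
  rw [weylSymbol, Finsupp.linearCombination_apply, Finsupp.sum, finsetSum_coeff,
    Finset.sum_eq_single a]
  · simp [ha]
  · rintro ⟨i, j⟩ _ hne
    rw [coeff_smul]
    split_ifs with h
    · have hj : a.2 ≠ j := by
        rintro rfl
        refine hne (Prod.ext ?_ rfl)
        simp only [weylWeight] at h ha
        have : q * i = q * a.1 := by linarith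
        exact_mod_cast mul_left_cancel₀ hq.ne' this
      simp [coeff_X_pow, hj]
    · simp
  · intro h
    simp [Finsupp.notMem_support_iff.1 h]

theorem mem_weightLE_sub_one {q p n : ℤ} (hq : 0 < q) {c : (ℕ × ℕ) →₀ ℂ}
    (hc : c ∈ weightLE q p n) (h : weylSymbol q p n c = 0) : c ∈ weightLE q p (n - 1) := by
  rw [mem_weightLE] at hc ⊢
  intro a ha
  rcases lt_or_eq_of_le (show n ≤ weylWeight q p a by omega) with h1 | h1
  · exact hc a h1
  · rw [← coeff_weylSymbol hq c a h1.symm, h, coeff_zero]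

theorem weylWeight_star_term {q p : ℤ} (a b : ℕ × ℕ) {r : ℕ} (ha : r ≤ a.2) (hb : r ≤ b.1) :
    weylWeight q p (a.1 + (b.1 - r), a.2 - r + b.2) =
      weylWeight q p a + weylWeight q p b - r * (p + q) := by
  simp only [weylWeight]
  push_cast [Nat.cast_sub ha, Nat.cast_sub hb]
  ring

theorem weylSymbol_starMonomial (q p k : ℤ) (a b : ℕ × ℕ) :
    weylSymbol q p k (starMonomial a b) = ∑ r ∈ Finset.range (a.2 + 1 + 1),
      if weylWeight q p a + weylWeight q p b - r * (p + q) = k then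
        ((a.2.choose r * b.1.descFactorial r : ℕ) : ℂ) • (X ^ (a.2 - r + b.2) : ℂ[X]) else 0 := by
  rw [Finset.sum_range_succ, Nat.choose_succ_self, zero_mul, Nat.cast_zero, zero_smul, ite_self,
    add_zero, starMonomial, map_sum]
  refine Finset.sum_congr rfl fun r hr => ?_
  rw [weylSymbol_single]
  rcases lt_or_ge b.1 r with h | h
  · simp [Nat.descFactorial_of_lt h]
  · rw [weylWeight_star_term a b (by simpa [Nat.lt_succ_iff] using hr) h]

theorem weylStar_mem_weightLE {q p n m : ℤ} (hpq : 0 ≤ p + q) {c d : (ℕ × ℕ) →₀ ℂ}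
    (hc : c ∈ weightLE q p n) (hd : d ∈ weightLE q p m) : weylStar c d ∈ weightLE q p (n + m) := by
  rw [← Submodule.Quotient.mk_eq_zero]
  have key := bilinear_eq_of_mem_supported (c := c) (d := d)
    (weylStar.compr₂ (weightLE q p (n + m)).mkQ) 0 ?_ hc hd
  · exact key
  intro a ha b hb
  simp only [LinearMap.compr₂_apply, weylStar_single_one, LinearMap.zero_apply, Submodule.mkQ_apply,
    Submodule.Quotient.mk_eq_zero, starMonomial]
  refine Submodule.sum_mem _ fun r hr => ?_
  rcases lt_or_ge b.1 r with h | h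
  · simp [Nat.descFactorial_of_lt h]
  · refine Finsupp.single_mem_supported ℂ _ ?_
    rw [Set.mem_ofPred_eq] at ha hb ⊢
    rw [weylWeight_star_term a b (by simpa [Nat.lt_succ_iff] using hr) h]
    have : 0 ≤ (r : ℤ) * (p + q) := by positivity
    linarith

theorem weylSymbol_star {q p n m : ℤ} (hpq : 0 < p + q) {c d : (ℕ × ℕ) →₀ ℂ}
    (hc : c ∈ weightLE q p n) (hd : d ∈ weightLE q p m) :
    weylSymbol q p (n + m) (weylStar c d) = weylSymbol q p n c * weylSymbol q p m d := by
  have key := bilinear_eq_of_mem_supported (c := c) (d := d)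
    (weylStar.compr₂ (weylSymbol q p (n + m)))
    (mulBilinear (weylSymbol q p n) (weylSymbol q p m)) ?_ hc hd
  · exact key
  intro a ha b hb
  rw [Set.mem_ofPred_eq] at ha hb
  have hr : ∀ r : ℕ, weylWeight q p a + weylWeight q p b - ((r + 1 : ℕ) : ℤ) * (p + q) ≠ n + m := by
    intro r
    have : 0 ≤ (r : ℤ) * (p + q) := by positivity
    push_cast
    linarith
  simp only [LinearMap.compr₂_apply, weylStar_single_one, mulBilinear_apply, weylSymbol_starMonomial, weylSymbol_single]
  rw [Finset.sum_range_succ', Finset.sum_eq_zero fun r _ => if_neg (hr r)]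
  by_cases h1 : weylWeight q p a = n <;> by_cases h2 : weylWeight q p b = m
  · simp [h1, h2, pow_add]
  all_goals
    have : weylWeight q p a + weylWeight q p b ≠ n + m := by omega
    simp [h1, h2, this]

theorem weylSymbol_starMonomial_subleading {q p n m : ℤ} (hpq : 0 < p + q) {a b : ℕ × ℕ}
    (ha : weylWeight q p a ≤ n) (hb : weylWeight q p b ≤ m) :
    weylSymbol q p (n + m - (p + q)) (starMonomial a b) =
      (if weylWeight q p a + weylWeight q p b = n + m - (p + q) then X ^ (a.2 + b.2) else 0) +
      if weylWeight q p a = n ∧ weylWeight q p b = m then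
        ((a.2 * b.1 : ℕ) : ℂ) • X ^ (a.2 - 1 + b.2) else 0 := by
  have hr : ∀ r : ℕ, weylWeight q p a + weylWeight q p b - ((r + 1 + 1 : ℕ) : ℤ) * (p + q) ≠
      n + m - (p + q) := by
    intro r
    have : 0 ≤ (r : ℤ) * (p + q) := by positivity
    push_cast
    linarith
  have h1 : weylWeight q p a + weylWeight q p b - ((0 + 1 : ℕ) : ℤ) * (p + q) =
      n + m - (p + q) ↔ weylWeight q p a = n ∧ weylWeight q p b = m := by
    push_cast
    constructor
    · intro h
      constructor <;> linarith
    · rintro ⟨rfl, rfl⟩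
      ring
  rw [weylSymbol_starMonomial, Finset.sum_range_succ', Finset.sum_range_succ',
    Finset.sum_eq_zero fun r _ => if_neg (hr r)]
  simp only [h1]
  rw [zero_add, add_comm]
  simp

theorem weylSymbol_commutator {q p n m : ℤ} (hpq : 0 < p + q) {c d : (ℕ × ℕ) →₀ ℂ}
    (hc : c ∈ weightLE q p n) (hd : d ∈ weightLE q p m) :
    (q : ℂ) • weylSymbol q p (n + m - (p + q)) (weylStar c d - weylStar d c) =
      (m : ℂ) • (derivative (weylSymbol q p n c) * weylSymbol q p m d) -
        (n : ℂ) • (weylSymbol q p n c * derivative (weylSymbol q p m d)) := by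
  have key := bilinear_eq_of_mem_supported (c := c) (d := d)
    ((q : ℂ) • (weylStar.compr₂ (weylSymbol q p (n + m - (p + q))) -
      weylStar.flip.compr₂ (weylSymbol q p (n + m - (p + q)))))
    ((m : ℂ) • mulBilinear (derivative ∘ₗ weylSymbol q p n)
        (weylSymbol q p m) -
      (n : ℂ) • mulBilinear (weylSymbol q p n)
        (derivative ∘ₗ weylSymbol q p m)) ?_ hc hd
  · rw [map_sub]
    exact key
  intro a ha b hb
  rw [Set.mem_ofPred_eq] at ha hb
  have hba := weylSymbol_starMonomial_subleading hpq hb ha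
  rw [add_comm m n, add_comm (weylWeight q p b), add_comm b.2 a.2] at hba
  simp only [LinearMap.smul_apply, LinearMap.compr₂_apply, LinearMap.sub_apply,
    LinearMap.flip_apply, weylStar_single_one, mulBilinear_apply, LinearMap.comp_apply, weylSymbol_single,
    weylSymbol_starMonomial_subleading hpq ha hb, hba]
  by_cases h1 : weylWeight q p a = n <;> by_cases h2 : weylWeight q p b = m
  · have h1' : (n : ℂ) = q * a.1 + p * a.2 := by rw [← h1, weylWeight]; push_cast; ring
    have h2' : (m : ℂ) = q * b.1 + p * b.2 := by rw [← h2, weylWeight]; push_cast; ring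
    obtain ⟨i, j⟩ := a
    obtain ⟨k, l⟩ := b
    rw [h1', h2']
    simp only [h1, h2, if_true, and_self, one_smul, derivative_X_pow, smul_eq_C_mul]
    rcases j with _ | j <;> rcases l with _ | l <;>
      simp [pow_succ, pow_add] <;> ring
  all_goals simp [h1, h2]

theorem exists_weylStar_pow {q p n : ℤ} (hpq : 0 < p + q) {l : (ℕ × ℕ) →₀ ℂ}
    (hl : l ∈ weightLE q p n) (k : ℕ) : ∃ d ∈ weightLE q p (n * k),
      toOp d = toOp l ^ k ∧ weylSymbol q p (n * k) d = weylSymbol q p n l ^ k := by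
  induction k with
  | zero =>
    refine ⟨Finsupp.single (0, 0) 1, Finsupp.single_mem_supported ℂ _ (by simp [weylWeight]), ?_, ?_⟩
    · simp [toOp]
    · simp [weylSymbol_single, weylWeight]
  | succ k ih =>
    obtain ⟨d, hd, hop, hsym⟩ := ih
    have hk : n * ((k + 1 : ℕ) : ℤ) = n * k + n := by push_cast; ring
    rw [hk]
    exact ⟨weylStar d l, weylStar_mem_weightLE hpq.le hd hl, by rw [toOp_weylStar, hop, pow_succ],
      by rw [weylSymbol_star hpq hd hl, hsym, pow_succ]⟩

theorem mul_derivative_pow (F : ℂ[X]) (k : ℕ) :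
    F * derivative (F ^ k) = (k : ℂ[X]) * (derivative F * F ^ k) := by
  rcases k with _ | k
  · simp
  · rw [derivative_pow_succ, map_add, C_eq_natCast, map_one, Nat.cast_add_one]
    ring

theorem eq_mul_rootMultiplicity_of_simple_root {F F₁ G : ℂ[X]} {r a b : ℂ}
    (hF : F = (X - C r) * F₁) (hr : F₁.eval r ≠ 0) (hG : G ≠ 0)
    (h : a • (derivative F * G) = b • (F * derivative G)) :
    a = b * (G.rootMultiplicity r : ℂ) := by
  obtain ⟨G₁, hG₁, hnd⟩ := exists_eq_pow_rootMultiplicity_mul_and_not_dvd G hG r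
  generalize G.rootMultiplicity r = k at *
  rw [dvd_iff_isRoot, IsRoot.def] at hnd
  have hpow := mul_derivative_pow (X - C r) k
  rw [derivative_X_sub_C, one_mul] at hpow
  have h2 : (X - C r) ^ k * (C a * ((F₁ + (X - C r) * derivative F₁) * G₁)) =
      (X - C r) ^ k * (C b * (F₁ * ((k : ℂ[X]) * G₁ + (X - C r) * derivative G₁))) := by
    rw [hG₁, hF] at h
    simp only [derivative_mul, derivative_sub, derivative_X, derivative_C, smul_eq_C_mul,
      sub_zero, one_mul] at h
    linear_combination h + C b * F₁ * G₁ * hpow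
  have h3 := congrArg (eval r) (mul_left_cancel₀ (pow_ne_zero k (X_sub_C_ne_zero r)) h2)
  simp only [eval_mul, eval_add, eval_sub, eval_X, eval_C, eval_natCast, sub_self, zero_mul,
    add_zero] at h3
  exact mul_right_cancel₀ (mul_ne_zero hr hnd) (by linear_combination h3)

theorem natDegree_of_mul_derivative_eq {F H : ℂ[X]} (hF : F.Monic) (hd : 0 < F.natDegree)
    (hH : H ≠ 0) {k : ℕ} (h : F * derivative H = (k : ℂ[X]) * (derivative F * H)) :
    H.natDegree = k * F.natDegree := by
  obtain ⟨f, hf⟩ := Nat.exists_eq_succ_of_ne_zero hd.ne'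
  have hF1 : F.coeff (f + 1) = 1 := by rw [← Nat.succ_eq_add_one, ← hf]; exact hF
  have hdF : (derivative F).natDegree ≤ f := by
    have := natDegree_derivative_le F
    omega
  have hcF : (derivative F).coeff f = (f : ℂ) + 1 := by rw [coeff_derivative, hF1, one_mul]
  rcases he : H.natDegree with _ | e
  · obtain ⟨z, rfl⟩ := natDegree_eq_zero.1 he
    have hF' : derivative F ≠ 0 := by
      intro h0
      rw [h0, coeff_zero] at hcF
      exact Nat.cast_add_one_ne_zero f hcF.symm
    have hk : (k : ℂ[X]) = 0 := by simpa [hF', hH] using h.symm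
    simp [Nat.cast_eq_zero.1 hk]
  · have hdH : (derivative H).natDegree ≤ e := by
      have := natDegree_derivative_le H
      omega
    have h1 := coeff_mul_add_eq_of_natDegree_le (show F.natDegree ≤ f + 1 from hf.le) hdH
    have h2 := coeff_mul_add_eq_of_natDegree_le hdF he.le
    rw [h, show f + 1 + e = f + (e + 1) by ring, ← C_eq_natCast, coeff_C_mul, h2, hF1, hcF,
      coeff_derivative, one_mul] at h1
    have hlc : H.coeff (e + 1) ≠ 0 := by
      rw [← he]
      exact leadingCoeff_ne_zero.2 hH
    have h3 : ((k * (f + 1) : ℕ) : ℂ) = ((e + 1 : ℕ) : ℂ) :=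
      mul_right_cancel₀ hlc (by push_cast; linear_combination h1)
    rw [hf, Nat.succ_eq_add_one]
    exact_mod_cast h3.symm

theorem eq_C_mul_pow_of_mul_derivative_eq {F G : ℂ[X]} (hF : F.Monic) (hd : 0 < F.natDegree)
    {k : ℕ} (h : F * derivative G = (k : ℂ[X]) * (derivative F * G)) :
    ∃ a, G = C a * F ^ k := by
  rcases eq_or_ne G 0 with rfl | hG
  · exact ⟨0, by simp⟩
  refine ⟨G.leadingCoeff, sub_eq_zero.1 ?_⟩
  by_contra hH
  have hdeg := natDegree_of_mul_derivative_eq hF hd hH (k := k) (by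
    rw [derivative_sub, derivative_C_mul]
    linear_combination h - C G.leadingCoeff * mul_derivative_pow F k)
  refine hH (leadingCoeff_eq_zero.1 ?_)
  rw [leadingCoeff, hdeg, coeff_sub, coeff_C_mul, ← hF.natDegree_pow, (hF.pow k).coeff_natDegree,
    hF.natDegree_pow, ← natDegree_of_mul_derivative_eq hF hd hG h, coeff_natDegree, mul_one,
    sub_self]

/-- If the leading form of `toOp l` has a simple root, only polynomials in `toOp l` commute with
`toOp l`. -/
theorem exists_aeval_of_commute {q p n : ℤ} (hq : 0 < q) (hp : 0 ≤ p) (hn : 0 < n)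
    {l : (ℕ × ℕ) →₀ ℂ} (hl : l ∈ weightLE q p n) (hmonic : (weylSymbol q p n l).Monic)
    (hdeg : 0 < (weylSymbol q p n l).natDegree) {r : ℂ} {F₁ : ℂ[X]}
    (hroot : weylSymbol q p n l = (X - C r) * F₁) (hsimple : F₁.eval r ≠ 0)
    {c : (ℕ × ℕ) →₀ ℂ} (hcomm : toOp c * toOp l = toOp l * toOp c) :
    ∃ P : ℂ[X], toOp c = aeval (toOp l) P := by
  have hpq : 0 < p + q := by omega
  have main : ∀ (N : ℕ) (c : (ℕ × ℕ) →₀ ℂ), c ∈ weightLE q p ((N : ℤ) - 1) →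
      toOp c * toOp l = toOp l * toOp c → ∃ P : ℂ[X], toOp c = aeval (toOp l) P := by
    intro N
    induction N with
    | zero =>
      intro c hc _
      have h0 : c = 0 := by
        ext a
        refine mem_weightLE.1 hc a ?_
        have : 0 ≤ weylWeight q p a := by simp only [weylWeight]; positivity
        push_cast
        omega
      exact ⟨0, by simp [h0, toOp]⟩
    | succ N ih =>
      intro c hc hcomm
      have hN : ((N + 1 : ℕ) : ℤ) - 1 = N := by push_cast; ring
      rw [hN] at hc
      by_cases hG : weylSymbol q p N c = 0
      · exact ih c (mem_weightLE_sub_one hq hc hG) hcomm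
      have hstar : weylStar l c = weylStar c l :=
        toOp_injective (by rw [toOp_weylStar, toOp_weylStar, hcomm])
      have hbr := weylSymbol_commutator hpq hl hc
      rw [hstar, sub_self, map_zero, smul_zero, eq_comm, sub_eq_zero] at hbr
      have hmult := eq_mul_rootMultiplicity_of_simple_root hroot hsimple hG hbr
      set k := (weylSymbol q p N c).rootMultiplicity r
      have hNk : (N : ℤ) = n * k := by exact_mod_cast hmult
      have hn0 : (n : ℂ) ≠ 0 := by exact_mod_cast hn.ne'
      obtain ⟨a, ha⟩ := eq_C_mul_pow_of_mul_derivative_eq hmonic hdeg (k := k)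
        (G := weylSymbol q p N c) (by
          rw [hmult, mul_smul] at hbr
          rw [← smul_right_injective _ hn0 hbr, smul_eq_C_mul, C_eq_natCast])
      obtain ⟨d, hd, hop, hsym⟩ := exists_weylStar_pow hpq hl k
      rw [← hNk] at hd hsym
      have hsub : toOp (c - a • d) = toOp c - a • toOp l ^ k := by
        rw [← hop]
        simp only [toOp_eq_linearCombination, map_sub, map_smul]
      have hpow : toOp l ^ k * toOp l = toOp l * toOp l ^ k := (Commute.refl _).pow_left k
      obtain ⟨P, hP⟩ := ih (c - a • d)
        (mem_weightLE_sub_one hq (Submodule.sub_mem _ hc (Submodule.smul_mem _ a hd))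
          (by rw [map_sub, map_smul, hsym, ha, smul_eq_C_mul, sub_self]))
        (by rw [hsub, sub_mul, mul_sub, hcomm, smul_mul_assoc, mul_smul_comm, hpow])
      refine ⟨P + C a * X ^ k, ?_⟩
      rw [map_add, ← hP, hsub, map_mul, aeval_C, map_pow, aeval_X, ← Algebra.smul_def]
      abel
  have hfin : ∃ N : ℕ, c ∈ weightLE q p ((N : ℤ) - 1) := by
    refine ⟨(c.support.sup fun a => (weylWeight q p a).toNat) + 1, ?_⟩
    rw [mem_weightLE]
    intro a ha
    by_contra h
    have := Finset.le_sup (f := fun a => (weylWeight q p a).toNat) (Finsupp.mem_support_iff.2 h)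
    push_cast at ha
    omega
  obtain ⟨N, hN⟩ := hfin
  exact main N c hN hcomm

theorem exists_simple_root_of_not_sq {F : ℂ[X]} (hF : F.Monic) (hd : F.natDegree = 4)
    (hsq : ∀ Q : ℂ[X], F ≠ Q ^ 2) : ∃ r F₁, F = (X - C r) * F₁ ∧ F₁.eval r ≠ 0 := by
  by_contra! hcon
  have factor : ∀ Q : ℂ[X], Q.Monic → Q.natDegree ≠ 0 → ∃ (r : ℂ) (Q₁ : ℂ[X]),
      Q = (X - C r) * Q₁ ∧ Q₁.Monic ∧ Q.natDegree = Q₁.natDegree + 1 := by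
    intro Q hQ hQd
    obtain ⟨r, hr⟩ := IsAlgClosed.exists_root Q
      (fun h => hQd (natDegree_eq_of_degree_eq_some h))
    obtain ⟨Q₁, rfl⟩ := dvd_iff_isRoot.2 hr
    have hQ₁ : Q₁.Monic := (monic_X_sub_C r).of_mul_monic_left hQ
    refine ⟨r, Q₁, rfl, hQ₁, ?_⟩
    rw [(monic_X_sub_C r).natDegree_mul hQ₁, natDegree_X_sub_C, add_comm]
  obtain ⟨r, F₁, hF₁, hm₁, hd₁⟩ := factor F hF (by omega)
  obtain ⟨F₂, rfl⟩ := dvd_iff_isRoot.2 (hcon r F₁ hF₁)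
  have hm₂ : F₂.Monic := (monic_X_sub_C r).of_mul_monic_left hm₁
  have hd₂ : F₂.natDegree = 2 := by
    rw [(monic_X_sub_C r).natDegree_mul hm₂, natDegree_X_sub_C] at hd₁
    omega
  obtain ⟨s, F₃, rfl, hm₃, hd₃⟩ := factor F₂ hm₂ (by omega)
  obtain ⟨t, F₄, rfl, hm₄, hd₄⟩ := factor F₃ hm₃ (by omega)
  obtain rfl : F₄ = 1 := hm₄.natDegree_eq_zero.1 (by omega)
  have hs := hcon s ((X - C r) ^ 2 * (X - C t)) (by rw [hF₁]; ring)
  have ht := hcon t ((X - C r) ^ 2 * (X - C s)) (by rw [hF₁]; ring)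
  simp only [eval_mul, eval_pow, eval_sub, eval_X, eval_C, mul_eq_zero, pow_eq_zero_iff, ne_eq,
    OfNat.ofNat_ne_zero, not_false_eq_true, sub_eq_zero] at hs ht
  rcases eq_or_ne s t with rfl | hst
  · exact hsq ((X - C r) * (X - C s)) (by rw [hF₁]; ring)
  · obtain rfl := hs.resolve_right hst
    obtain rfl := ht.resolve_right hst.symm
    exact hst rfl

theorem quartic_ne_sq {A B D : ℂ} (h : B ≠ 0 ∨ 4 * D ≠ A ^ 2) (Q : ℂ[X]) :
    X ^ 4 + C A * X ^ 2 + C B * X + C D ≠ Q ^ 2 := by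
  intro hQ
  have hnd : (X ^ 4 + C A * X ^ 2 + C B * X + C D).natDegree = 4 := by compute_degree!
  have hQd : Q.natDegree ≤ 2 := by
    rw [hQ, natDegree_pow] at hnd
    omega
  rw [Q.as_sum_range_C_mul_X_pow' (show Q.natDegree < 3 by omega)] at hQ
  generalize Q.coeff = z at hQ
  have hexp : X ^ 4 + C A * X ^ 2 + C B * X + C D =
      C (z 2 ^ 2) * X ^ 4 + C (2 * z 1 * z 2) * X ^ 3 + C (z 1 ^ 2 + 2 * z 0 * z 2) * X ^ 2 +
        C (2 * z 0 * z 1) * X + C (z 0 ^ 2) := by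
    rw [hQ]
    simp only [Finset.sum_range_succ, Finset.sum_range_zero, map_mul, map_add, map_pow, map_ofNat]
    ring
  have h4 := congrArg (fun f => coeff f 4) hexp
  have h3 := congrArg (fun f => coeff f 3) hexp
  have h2 := congrArg (fun f => coeff f 2) hexp
  have h1 := congrArg (fun f => coeff f 1) hexp
  have h0 := congrArg (fun f => coeff f 0) hexp
  simp only [coeff_add, coeff_C_mul, coeff_X_pow, coeff_X, coeff_C] at h4 h3 h2 h1 h0
  norm_num at h4 h3 h2 h1 h0
  have hz2 : z 2 ≠ 0 := by
    intro h
    simp [h] at h4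
  have hz1 : z 1 = 0 := by simpa [hz2] using h3
  rcases h with h | h
  · exact h (by rw [h1, hz1, mul_zero])
  · refine h ?_
    rw [h0, h2, hz1]
    linear_combination (4 * z 0 ^ 2) * h4

/-- The coefficient family of the operator `P ∂^j`. -/
noncomputable def coeffFamily (j : ℕ) (P : ℂ[X]) : (ℕ × ℕ) →₀ ℂ :=
  ∑ i ∈ P.support, Finsupp.single (i, j) (P.coeff i)

theorem mulP_eq_aeval (P : ℂ[X]) : mulP P = aeval Wx P := by
  refine LinearMap.ext fun f => ?_
  rw [aeval_eq_sum_range, LinearMap.sum_apply, mulP, LinearMap.mulLeft_apply]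
  conv_lhs => rw [P.as_sum_range_C_mul_X_pow, Finset.sum_mul]
  refine Finset.sum_congr rfl fun i _ => ?_
  rw [LinearMap.smul_apply, Wx_pow_apply, smul_eq_C_mul, mul_assoc]

theorem toOp_coeffFamily (j : ℕ) (P : ℂ[X]) : toOp (coeffFamily j P) = mulP P * Wd ^ j := by
  rw [toOp_eq_linearCombination, coeffFamily, map_sum, mulP_eq_aeval, aeval_def, eval₂_eq_sum,
    Polynomial.sum, Finset.sum_mul]
  refine Finset.sum_congr rfl fun i _ => ?_
  rw [Finsupp.linearCombination_single, weylMonomial, ← Algebra.smul_def, smul_mul_assoc]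

theorem coeffFamily_mem_weightLE {q p n : ℤ} {j : ℕ} {P : ℂ[X]}
    (h : ∀ i, n < weylWeight q p (i, j) → P.coeff i = 0) : coeffFamily j P ∈ weightLE q p n := by
  refine Submodule.sum_mem _ fun i hi => Finsupp.single_mem_supported ℂ _ ?_
  by_contra hlt
  exact mem_support_iff.1 hi (h i (not_le.1 hlt))

theorem exists_weylSymbol_coeffFamily {q : ℤ} (hq : 0 < q) (p n : ℤ) (j : ℕ) (P : ℂ[X]) :
    ∃ A : ℂ, weylSymbol q p n (coeffFamily j P) = C A * X ^ j ∧
      (∀ i, weylWeight q p (i, j) = n → A = P.coeff i) ∧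
      ((∀ i, weylWeight q p (i, j) ≠ n) → A = 0) := by
  refine ⟨∑ i ∈ P.support, if weylWeight q p (i, j) = n then P.coeff i else 0, ?_, ?_, ?_⟩
  · rw [coeffFamily, map_sum, map_sum, Finset.sum_mul]
    refine Finset.sum_congr rfl fun i _ => ?_
    rw [weylSymbol_single, smul_eq_C_mul]
    split_ifs <;> simp
  · intro i hi
    rw [Finset.sum_eq_single i]
    · rw [if_pos hi]
    · intro k _ hk
      refine if_neg fun h => hk ?_
      simp only [weylWeight] at h hi
      have : q * k = q * i := by linarith
      exact_mod_cast mul_left_cancel₀ hq.ne' this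
    · intro h
      rw [if_pos hi, notMem_support_iff.1 h]
  · intro h
    exact Finset.sum_eq_zero fun i _ => if_neg (h i)

theorem ordW_aeval_Wd {R : ℂ[X]} (hR : R ≠ 0) : OrdW (aeval Wd R) R.natDegree := by
  have happly : ∀ a : ℕ × ℕ, (∑ j ∈ R.support, Finsupp.single (0, j) (R.coeff j)) a =
      if a.1 = 0 then R.coeff a.2 else 0 := by
    rintro ⟨i, j⟩
    rw [Finsupp.finsetSum_apply]
    simp only [Finsupp.single_apply, Prod.mk.injEq]
    by_cases hi : i = 0
    · subst hi
      simp +contextual [eq_comm]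
    · simp [hi, Ne.symm hi]
  have hlead : R.coeff R.natDegree ≠ 0 := leadingCoeff_ne_zero.2 hR
  refine ⟨∑ j ∈ R.support, Finsupp.single (0, j) (R.coeff j), ?_, ?_, ?_⟩
  · rw [toOp_eq_linearCombination, map_sum, aeval_def, eval₂_eq_sum, Polynomial.sum]
    refine Finset.sum_congr rfl fun i _ => ?_
    rw [Finsupp.linearCombination_single, weylMonomial, ← Algebra.smul_def, pow_zero, one_mul]
  · intro h
    have := happly (0, R.natDegree)
    rw [h] at this
    exact hlead (by simpa using this.symm)
  · refine le_antisymm ?_ (Finset.sup_le fun a ha => ?_)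
    · refine Finset.le_sup (f := fun ij : ℕ × ℕ => ij.2) (b := (0, R.natDegree)) ?_
      rw [Finsupp.mem_support_iff, happly]
      simpa using hR
    · rw [Finsupp.mem_support_iff, happly] at ha
      exact le_natDegree_of_ne_zero (ne_of_apply_ne (fun z => if a.1 = 0 then z else 0)
        (by simpa using ha))

theorem not_irreducibleOp_aeval_Wd {R : ℂ[X]} (hR : 2 ≤ R.natDegree) :
    ¬ IrreducibleOp (aeval Wd R) := by
  intro hirr
  obtain ⟨r, hr⟩ := IsAlgClosed.exists_root R
    (fun h => by have := natDegree_eq_of_degree_eq_some (n := 0) h; omega)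
  obtain ⟨Q, rfl⟩ := dvd_iff_isRoot.2 hr
  have hQ : Q ≠ 0 := by
    rintro rfl
    simp at hR
  rw [natDegree_mul (X_sub_C_ne_zero r) hQ, natDegree_X_sub_C] at hR
  have h₁ := ordW_aeval_Wd (X_sub_C_ne_zero r)
  have h₂ := ordW_aeval_Wd hQ
  refine hirr ⟨aeval Wd (X - C r), aeval Wd Q, ⟨h₁.choose, h₁.choose_spec.1⟩,
    ⟨h₂.choose, h₂.choose_spec.1⟩, ⟨_, ?_, h₁⟩, ⟨_, ?_, h₂⟩, map_mul _ _ _⟩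
  · rw [natDegree_X_sub_C]
    exact one_pos
  · omega

/-- The coefficient family of `(∂² + V)² + U ∂ + W`. -/
noncomputable def quarticFamily (U V W : ℂ[X]) : (ℕ × ℕ) →₀ ℂ :=
  coeffFamily 4 1 + coeffFamily 2 (2 * V) + coeffFamily 1 (2 * derivative V + U) +
    coeffFamily 0 (derivative (derivative V) + V * V + W)

theorem toOp_quarticFamily (U V W : ℂ[X]) :
    toOp (quarticFamily U V W) = (Wd ^ 2 + mulP V) ^ 2 + mulP U * Wd + mulP W := by
  have hadd : ∀ c d, toOp (c + d) = toOp c + toOp d := fun c d => by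
    simp only [toOp_eq_linearCombination, map_add]
  rw [quarticFamily, hadd, hadd, hadd]
  simp only [toOp_coeffFamily]
  refine LinearMap.ext fun f => ?_
  simp only [pow_succ, pow_zero, one_mul, LinearMap.add_apply, Module.End.mul_apply, mulP,
    LinearMap.mulLeft_apply, Wd, mul_one, map_add, derivative_mul, add_mul,
    mul_add]
  ring

theorem quarticFamily_mem_weightLE {U V W : ℂ[X]} {p : ℕ} (hV : 6 * V.natDegree ≤ p)
    (hU : 4 * U.natDegree ≤ p) (hW : 3 * W.natDegree ≤ p) :
    quarticFamily U V W ∈ weightLE 12 p (4 * p) := by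
  refine Submodule.add_mem _ (Submodule.add_mem _ (Submodule.add_mem _ ?_ ?_) ?_) ?_ <;>
    refine coeffFamily_mem_weightLE fun i hi => ?_ <;>
    simp only [weylWeight] at hi <;> push_cast at hi
  · exact coeff_one.trans (if_neg (by omega))
  · rw [← C_ofNat, coeff_C_mul, coeff_eq_zero_of_natDegree_lt (by omega), mul_zero]
  · rw [coeff_add, ← C_ofNat, coeff_C_mul, coeff_derivative,
      coeff_eq_zero_of_natDegree_lt (p := V) (by omega),
      coeff_eq_zero_of_natDegree_lt (p := U) (by omega)]
    ring
  · rw [coeff_add, coeff_add, coeff_derivative, coeff_derivative,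
      coeff_eq_zero_of_natDegree_lt (p := V) (by omega),
      coeff_eq_zero_of_natDegree_lt (p := W) (by omega),
      coeff_eq_zero_of_natDegree_lt (p := V * V)
        (natDegree_mul_le.trans_lt (by omega))]
    ring

/-- The leading form of `(∂² + V)² + U ∂ + W` is not a square when `U` or `W` contributes to it. -/
theorem exists_weylSymbol_quarticFamily {U V W : ℂ[X]} {p : ℕ} (hp : 0 < p)
    (hV : 6 * V.natDegree ≤ p) (h : 4 * U.natDegree = p ∨ 3 * W.natDegree = p) :
    ∃ A B D : ℂ, weylSymbol 12 p (4 * p) (quarticFamily U V W) =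
      X ^ 4 + C A * X ^ 2 + C B * X + C D ∧ (B ≠ 0 ∨ 4 * D ≠ A ^ 2) := by
  have h12 : (0 : ℤ) < 12 := by norm_num
  obtain ⟨E, hE, hE1, -⟩ := exists_weylSymbol_coeffFamily h12 p (4 * p) 4 1
  obtain ⟨A, hA, hA1, hA0⟩ := exists_weylSymbol_coeffFamily h12 p (4 * p) 2 (2 * V)
  obtain ⟨B, hB, hB1, -⟩ :=
    exists_weylSymbol_coeffFamily h12 p (4 * p) 1 (2 * derivative V + U)
  obtain ⟨D, hD, hD1, -⟩ :=
    exists_weylSymbol_coeffFamily h12 p (4 * p) 0 (derivative (derivative V) + V * V + W)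
  simp only [weylWeight] at hE1 hA1 hA0 hB1 hD1
  push_cast at hE1 hA1 hA0 hB1 hD1
  refine ⟨A, B, D, ?_, ?_⟩
  · rw [quarticFamily, map_add, map_add, map_add, hE, hA, hB, hD, hE1 0 (by push_cast; ring)]
    simp
  rcases h with h | h
  · left
    rw [hB1 U.natDegree (by omega), coeff_add, ← C_ofNat, coeff_C_mul, coeff_derivative,
      coeff_eq_zero_of_natDegree_lt (p := V) (by omega), zero_mul, mul_zero, zero_add]
    exact leadingCoeff_ne_zero.2 (ne_zero_of_natDegree_gt (n := 0) (by omega))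
  · right
    have hlead : W.coeff W.natDegree ≠ 0 :=
      leadingCoeff_ne_zero.2 (ne_zero_of_natDegree_gt (n := 0) (by omega))
    rw [hD1 W.natDegree (by omega), coeff_add, coeff_add, coeff_derivative, coeff_derivative,
      coeff_eq_zero_of_natDegree_lt (p := V) (by omega)]
    rcases Nat.even_or_odd' W.natDegree with ⟨i, hi | hi⟩
    · rw [hA1 i (by omega), ← C_ofNat, coeff_C_mul]
      have hsq : (V * V).coeff W.natDegree = V.coeff i * V.coeff i := by
        rw [hi, two_mul]
        exact coeff_mul_add_eq_of_natDegree_le (by omega) (by omega)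
      rw [hsq]
      intro h0
      exact hlead (by linear_combination h0 / 4)
    · rw [hA0 (fun k hk => by omega), coeff_eq_zero_of_natDegree_lt (p := V * V)
        (natDegree_mul_le.trans_lt (by omega))]
      simpa using hlead

/-- Let `L₄ = (∂² + V)² + U ∂ + W` be an irreducible operator of order 4
in `A₁(ℂ)`, `U, V, W ∈ ℂ[x]`.  If the centralizer `𝒞(L₄)` is strictly larger than
`ℂ[L₄]`, then `deg V > max{deg U / 2, deg W / 2}` (equivalently `deg U < deg V²` and
`deg W < deg V²`). -/
theorem statement16 (U V W : Polynomial ℂ)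
    (L4 : Module.End ℂ (Polynomial ℂ))
    (hL4 : L4 = (Wd ^ 2 + mulP V) ^ 2 + mulP U * Wd + mulP W)
    (hirr : IrreducibleOp L4)
    (hbig : ∃ M : Module.End ℂ (Polynomial ℂ), InWeyl M ∧ M * L4 = L4 * M ∧
      ¬ ∃ p : Polynomial ℂ, M = Polynomial.aeval L4 p) :
    U.degree < (V * V).degree ∧ W.degree < (V * V).degree := by
  obtain ⟨M, ⟨c, rfl⟩, hcomm, hM⟩ := hbig
  by_cases hlt : 4 * U.natDegree < 6 * V.natDegree ∧ 3 * W.natDegree < 6 * V.natDegree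
  · have hV : V ≠ 0 := by
      rintro rfl
      simp at hlt
    have hdeg : (V * V).natDegree = V.natDegree + V.natDegree := natDegree_mul hV hV
    exact ⟨degree_lt_degree (by omega), degree_lt_degree (by omega)⟩
  exfalso
  obtain ⟨p, hpV, hpU, hpW, hp⟩ : ∃ p, 6 * V.natDegree ≤ p ∧ 4 * U.natDegree ≤ p ∧
      3 * W.natDegree ≤ p ∧ (4 * U.natDegree = p ∨ 3 * W.natDegree = p) := by
    rcases le_total (4 * U.natDegree) (3 * W.natDegree) with h | h
    · exact ⟨3 * W.natDegree, by omega, h, le_rfl, Or.inr rfl⟩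
    · exact ⟨4 * U.natDegree, by omega, le_rfl, h, Or.inl rfl⟩
  rcases Nat.eq_zero_or_pos p with rfl | hp0
  · obtain ⟨v, rfl⟩ := natDegree_eq_zero.1 (show V.natDegree = 0 by omega)
    obtain ⟨u, rfl⟩ := natDegree_eq_zero.1 (show U.natDegree = 0 by omega)
    obtain ⟨w, rfl⟩ := natDegree_eq_zero.1 (show W.natDegree = 0 by omega)
    have hL : L4 = aeval Wd ((X ^ 2 + C v) ^ 2 + C u * X + C w) := by
      simp [hL4, mulP_eq_aeval]
    refine not_irreducibleOp_aeval_Wd ?_ (hL ▸ hirr)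
    have : ((X ^ 2 + C v) ^ 2 + C u * X + C w).natDegree = 4 := by compute_degree!
    omega
  · rw [← toOp_quarticFamily] at hL4
    subst hL4
    obtain ⟨A, B, D, hsym, hsq⟩ := exists_weylSymbol_quarticFamily hp0 hpV hp
    have hdeg : (X ^ 4 + C A * X ^ 2 + C B * X + C D).natDegree = 4 := by compute_degree!
    have hmonic : (X ^ 4 + C A * X ^ 2 + C B * X + C D).Monic := by monicity!
    obtain ⟨r, F₁, hF, hr⟩ := exists_simple_root_of_not_sq hmonic hdeg (quartic_ne_sq hsq)
    rw [← hsym] at hF hdeg hmonic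
    exact hM (exists_aeval_of_commute (by norm_num) (by positivity) (by positivity)
      (quarticFamily_mem_weightLE hpV hpU hpW) hmonic (by omega) hF hr hcomm)
end

section
/- Let L₄ = (∂² + V(x))² + U(x)∂ + W(x) be an irreducible operator of order 4 in A₁(ℂ), with U, V, W ∈ ℂ[x], and suppose 𝒞(L₄) ≠ ℂ[L₄]. Then there exists an operator X₂ ∈ 𝒞(L₄), of minimal order among elements of 𝒞(L₄) whose order is congruent to 2 modulo 4, such that ord(X₂) = 2(2g+1) for some integer g ≥ 1, the centralizer 𝒞(L₄) is the free ℂ[L₄]-module with basis {1, X₂} (so 𝒞(L₄) = ℂ[L₄, X₂]), and the pair L₄, X₂ is a BC pair of true rank 2. -/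
open scoped BigOperators

/-- Membership in the centralizer `𝒞(L)` of `L` in `A₁(ℂ)`. -/
def InCentW (L P : Module.End ℂ (Polynomial ℂ)) : Prop :=
  InWeyl P ∧ P * L = L * P

namespace WeylSymbol

open Polynomial

/-- The operator `Σ a_j ∂^j` with full symbol `Σ a_j Y^j`. -/
noncomputable def op : ℂ[X][X] →ₗ[ℂ] Module.End ℂ ℂ[X] :=
  Polynomial.lsum fun j => LinearMap.mulRight ℂ (Wd ^ j) ∘ₗ LinearMap.mul ℂ ℂ[X]

/-- Coefficientwise differentiation `∂/∂x` of symbols. -/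
noncomputable def derivX : ℂ[X][X] →ₗ[ℂ] ℂ[X][X] :=
  Polynomial.lsum fun j => (monomial j).restrictScalars ℂ ∘ₗ derivative

/-- The full symbol with prescribed coefficients. -/
noncomputable def symbol : ((ℕ × ℕ) →₀ ℂ) →ₗ[ℂ] ℂ[X][X] :=
  Finsupp.linearCombination ℂ fun ij => monomial ij.2 (monomial ij.1 1)

lemma op_monomial (j : ℕ) (a : ℂ[X]) : op (monomial j a) = mulP a * Wd ^ j := by
  simp only [op, Polynomial.lsum_apply]
  rw [sum_monomial_index _ _ (by simp)]
  rfl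

lemma derivX_monomial (j : ℕ) (a : ℂ[X]) :
    derivX (monomial j a) = monomial j (derivative a) := by
  simp only [derivX, Polynomial.lsum_apply]
  rw [sum_monomial_index _ _ (by simp)]
  rfl

lemma bivariate_induction {motive : ℂ[X][X] → Prop} (p : ℂ[X][X])
    (add : ∀ p q, motive p → motive q → motive (p + q))
    (mon : ∀ i j z, motive (monomial j (monomial i z))) : motive p := by
  induction p using Polynomial.induction_on' with
  | add p q hp hq => exact add p q hp hq
  | monomial j a =>
    induction a using Polynomial.induction_on' with
    | add a b ha hb => rw [map_add]; exact add _ _ ha hb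
    | monomial i z => exact mon i j z

lemma coeff_derivX (p : ℂ[X][X]) (j : ℕ) : (derivX p).coeff j = derivative (p.coeff j) := by
  induction p using Polynomial.induction_on' with
  | add p q hp hq => simp [hp, hq]
  | monomial n a => rw [derivX_monomial, coeff_monomial, coeff_monomial]; split_ifs <;> simp

lemma coeff_derivX_pow (p : ℂ[X][X]) (k j : ℕ) :
    ((derivX ^ k) p).coeff j = derivative^[k] (p.coeff j) := by
  induction k generalizing p with
  | zero => rfl
  | succ k ih => rw [pow_succ, Module.End.mul_apply, ih, coeff_derivX, Function.iterate_succ_apply]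

lemma natDegree_derivX_pow_le (p : ℂ[X][X]) (k : ℕ) :
    ((derivX ^ k) p).natDegree ≤ p.natDegree := by
  rw [natDegree_le_iff_coeff_eq_zero]
  intro j hj
  rw [coeff_derivX_pow, coeff_eq_zero_of_natDegree_lt hj, iterate_derivative_zero]

lemma mulP_one : mulP 1 = 1 := by
  refine LinearMap.ext fun f => ?_; simp [mulP]

lemma mulP_mul (a b : ℂ[X]) : mulP (a * b) = mulP a * mulP b := by
  refine LinearMap.ext fun f => ?_; simp [mulP]

lemma mulP_C (z : ℂ) : mulP (C z) = algebraMap ℂ _ z := by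
  refine LinearMap.ext fun f => ?_; simp [mulP, Module.algebraMap_end_apply, smul_eq_C_mul]

lemma Wd_mul_mulP (a : ℂ[X]) : Wd * mulP a = mulP (derivative a) + mulP a * Wd := by
  refine LinearMap.ext fun f => ?_; simp [mulP, Wd]

lemma mulP_mul_op (a : ℂ[X]) (q : ℂ[X][X]) : mulP a * op q = op (C a * q) := by
  induction q using Polynomial.induction_on' with
  | add p q hp hq => simp only [map_add, mul_add, hp, hq]
  | monomial n b => rw [C_mul_monomial, op_monomial, op_monomial, mulP_mul, mul_assoc]

lemma Wd_mul_op (q : ℂ[X][X]) : Wd * op q = op (derivX q + X * q) := by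
  induction q using Polynomial.induction_on' with
  | add p q hp hq => rw [map_add, mul_add, hp, hq]; simp only [map_add, mul_add]; abel
  | monomial n b =>
    rw [derivX_monomial, X_mul_monomial, map_add, op_monomial, op_monomial, op_monomial,
      ← mul_assoc, Wd_mul_mulP, pow_succ', add_mul, mul_assoc]

lemma commute_derivX_mulLeft : Commute derivX (LinearMap.mulLeft ℂ (X : ℂ[X][X])) := by
  apply LinearMap.ext
  intro q
  simp only [Module.End.mul_apply, LinearMap.mulLeft_apply]
  induction q using Polynomial.induction_on' with
  | add p q hp hq => simp only [mul_add, map_add, hp, hq]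
  | monomial n b => simp only [X_mul_monomial, derivX_monomial]

lemma Wd_pow_mul_op (j : ℕ) (q : ℂ[X][X]) :
    Wd ^ j * op q =
      op (∑ k ∈ Finset.range (j + 1), (j.choose k) • (X ^ (j - k) * (derivX ^ k) q)) := by
  have h : Wd ^ j * op q = op (((derivX + LinearMap.mulLeft ℂ (X : ℂ[X][X])) ^ j) q) := by
    induction j generalizing q with
    | zero => simp
    | succ j ih =>
      rw [pow_succ, mul_assoc, Wd_mul_op, ih, pow_succ]
      simp
  rw [h, commute_derivX_mulLeft.add_pow]
  congr 1
  rw [LinearMap.sum_apply]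
  refine Finset.sum_congr rfl fun k _ => ?_
  rw [(commute_derivX_mulLeft.pow_pow k (j - k)).eq, LinearMap.pow_mulLeft, mul_assoc,
    ← nsmul_eq_mul']
  simp [mul_left_comm]

/-- Composition of operators in terms of their full symbols. -/
lemma op_mul_op (p q : ℂ[X][X]) {K : ℕ} (hK : p.natDegree < K) :
    op p * op q = op (∑ k ∈ Finset.range K, hasseDeriv k p * (derivX ^ k) q) := by
  have hmon : ∀ j < K, ∀ a : ℂ[X], op (monomial j a) * op q =
      op (∑ k ∈ Finset.range K, hasseDeriv k (monomial j a) * (derivX ^ k) q) := by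
    intro j hj a
    rw [op_monomial, mul_assoc, Wd_pow_mul_op, mulP_mul_op, Finset.mul_sum]
    refine congrArg op (Finset.sum_subset_zero_on_sdiff
      (Finset.range_subset_range.2 (Nat.succ_le_of_lt hj)) ?_ ?_)
    · intro k hk
      have : j < k := by simp at hk; omega
      simp [hasseDeriv_monomial, Nat.choose_eq_zero_of_lt this]
    · intro k hk
      rw [hasseDeriv_monomial, ← C_mul_X_pow_eq_monomial]
      simp only [nsmul_eq_mul, map_mul, map_natCast]
      ring
  conv_lhs => rw [p.as_sum_range' K hK]
  conv_rhs => rw [p.as_sum_range' K hK]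
  simp only [map_sum, Finset.sum_mul]
  rw [Finset.sum_comm]
  refine Finset.sum_congr rfl fun j hj => ?_
  rw [hmon j (Finset.mem_range.1 hj), map_sum]

lemma op_injective : Function.Injective op := by
  rw [injective_iff_map_eq_zero]
  intro p hp
  by_contra hne
  classical
  have hex : ∃ j, p.coeff j ≠ 0 := by
    by_contra! h
    exact hne (Polynomial.ext h)
  have happ : ∀ q : ℂ[X][X], ∀ f, op q f = q.sum fun j a => a * derivative^[j] f := by
    intro q f
    simp only [op, Polynomial.lsum_apply, Polynomial.sum_def, LinearMap.sum_apply]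
    refine Finset.sum_congr rfl fun j _ => ?_
    simp [Wd, Module.End.pow_apply]
  have h0 : op p (X ^ Nat.find hex) = 0 := by rw [hp]; rfl
  rw [happ, Polynomial.sum_def, Finset.sum_eq_single (Nat.find hex)] at h0
  · rw [iterate_derivative_X_pow_eq_natCast_mul] at h0
    refine mul_ne_zero (Nat.find_spec hex) ?_ h0
    simp [Nat.descFactorial_self, Nat.factorial_ne_zero]
  · intro j hj hne'
    have hlt : Nat.find hex < j :=
      lt_of_le_of_ne (Nat.find_min' hex (mem_support_iff.1 hj)) (Ne.symm hne')
    rw [iterate_derivative_eq_zero (by simpa using hlt), mul_zero]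
  · intro h
    rw [notMem_support_iff.1 h, zero_mul]

lemma coeff_symbol (c : (ℕ × ℕ) →₀ ℂ) (i j : ℕ) : ((symbol c).coeff j).coeff i = c (i, j) := by
  induction c using Finsupp.induction_linear with
  | zero => simp
  | add f g hf hg => simp [hf, hg]
  | single ij z =>
    obtain ⟨a, b⟩ := ij
    simp only [symbol, Finsupp.linearCombination_single, smul_monomial, coeff_monomial,
      Finsupp.single_apply, Prod.mk.injEq]
    by_cases h : b = j <;> by_cases h' : a = i <;> simp [h, h', coeff_monomial]

lemma symbol_surjective : Function.Surjective symbol := by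
  intro p
  induction p using bivariate_induction with
  | add p q hp hq =>
    obtain ⟨c, rfl⟩ := hp
    obtain ⟨d, rfl⟩ := hq
    exact ⟨c + d, map_add _ _ _⟩
  | mon i j z => exact ⟨Finsupp.single (i, j) z, by simp [symbol, smul_monomial]⟩

lemma toOp_eq_op_symbol (c : (ℕ × ℕ) →₀ ℂ) : toOp c = op (symbol c) := by
  have hx : ∀ i, Wx ^ i = mulP (monomial i 1) := by
    intro i
    rw [Wx, LinearMap.pow_mulLeft, mulP, X_pow_eq_monomial]
  have : toOp c = Finsupp.linearCombination ℂ (fun ij : ℕ × ℕ => Wx ^ ij.1 * Wd ^ ij.2) c := rfl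
  rw [this, symbol, Finsupp.apply_linearCombination]
  congr 2
  funext ij
  simp only [Function.comp_apply, op_monomial, hx]

lemma inWeyl_iff (P : Module.End ℂ ℂ[X]) : InWeyl P ↔ ∃ p, P = op p := by
  constructor
  · rintro ⟨c, rfl⟩
    exact ⟨_, toOp_eq_op_symbol c⟩
  · rintro ⟨p, rfl⟩
    obtain ⟨c, rfl⟩ := symbol_surjective p
    exact ⟨c, (toOp_eq_op_symbol c).symm⟩

lemma natDegree_symbol (c : (ℕ × ℕ) →₀ ℂ) :
    (symbol c).natDegree = c.support.sup fun ij => ij.2 := by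
  apply le_antisymm
  · rw [natDegree_le_iff_coeff_eq_zero]
    intro j hj
    ext i
    rw [coeff_symbol, coeff_zero]
    by_contra h
    exact absurd (Finset.le_sup (f := fun ij : ℕ × ℕ => ij.2) (Finsupp.mem_support_iff.2 h))
      (not_le.2 hj)
  · refine Finset.sup_le fun ij hij => le_natDegree_of_ne_zero fun h => ?_
    rw [Finsupp.mem_support_iff, ← Prod.mk.eta (p := ij), ← coeff_symbol, h] at hij
    exact hij (coeff_zero _)

lemma ordW_iff (P : Module.End ℂ ℂ[X]) (k : ℕ) :
    OrdW P k ↔ ∃ p, P = op p ∧ p ≠ 0 ∧ k = p.natDegree := by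
  have hinj : Function.Injective symbol := by
    intro c d h
    ext ⟨i, j⟩
    rw [← coeff_symbol, h, coeff_symbol]
  constructor
  · rintro ⟨c, rfl, hc, rfl⟩
    exact ⟨_, toOp_eq_op_symbol c, (map_ne_zero_iff _ hinj).2 hc, (natDegree_symbol c).symm⟩
  · rintro ⟨p, rfl, hp, rfl⟩
    obtain ⟨c, rfl⟩ := symbol_surjective p
    exact ⟨c, (toOp_eq_op_symbol c).symm, (map_ne_zero_iff _ hinj).1 hp, natDegree_symbol c⟩

lemma sum_commutator_eq_zero {p q : ℂ[X][X]} (h : op p * op q = op q * op p) {K : ℕ}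
    (hp : p.natDegree < K) (hq : q.natDegree < K) :
    ∑ k ∈ Finset.range K,
      (hasseDeriv k p * (derivX ^ k) q - hasseDeriv k q * (derivX ^ k) p) = 0 := by
  rw [op_mul_op p q hp, op_mul_op q p hq] at h
  rw [Finset.sum_sub_distrib, op_injective h, sub_self]

/-- `P` has order at most `k`, and the coefficient of `∂^k` in `P` is the constant `c`. -/
def HasLead (P : Module.End ℂ ℂ[X]) (k : ℕ) (c : ℂ) : Prop :=
  ∃ p, P = op p ∧ p.natDegree ≤ k ∧ p.coeff k = C c

lemma HasLead.mul {P Q : Module.End ℂ ℂ[X]} {k l : ℕ} {c d : ℂ} (hP : HasLead P k c)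
    (hQ : HasLead Q l d) : HasLead (P * Q) (k + l) (c * d) := by
  obtain ⟨p, rfl, hp, hpc⟩ := hP
  obtain ⟨q, rfl, hq, hqd⟩ := hQ
  have hdeg : ∀ i, (hasseDeriv i p * (derivX ^ i) q).natDegree ≤ (k - i) + l := fun i =>
    natDegree_mul_le_of_le ((natDegree_hasseDeriv_le p i).trans (Nat.sub_le_sub_right hp i))
      ((natDegree_derivX_pow_le q i).trans hq)
  refine ⟨_, op_mul_op p q (Nat.lt_succ_of_le hp), ?_, ?_⟩
  · exact natDegree_sum_le_of_forall_le _ _ fun i _ => (hdeg i).trans (by omega)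
  · rw [finsetSum_coeff, Finset.sum_eq_single 0]
    · rw [hasseDeriv_zero', pow_zero, Module.End.one_apply, coeff_mul_add_eq_of_natDegree_le hp hq,
        hpc, hqd, C_mul]
    · intro i hi hi0
      rw [Finset.mem_range] at hi
      exact coeff_eq_zero_of_natDegree_lt ((hdeg i).trans_lt (by omega))
    · simp

lemma HasLead.add {P Q : Module.End ℂ ℂ[X]} {k : ℕ} {c d : ℂ} (hP : HasLead P k c)
    (hQ : HasLead Q k d) : HasLead (P + Q) k (c + d) := by
  obtain ⟨p, rfl, hp, hpc⟩ := hP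
  obtain ⟨q, rfl, hq, hqd⟩ := hQ
  exact ⟨p + q, (map_add _ _ _).symm, natDegree_add_le_of_degree_le hp hq, by
    rw [coeff_add, hpc, hqd, C_add]⟩

lemma HasLead.of_lt {P : Module.End ℂ ℂ[X]} {k l : ℕ} {c : ℂ} (hP : HasLead P k c)
    (h : k < l) : HasLead P l 0 := by
  obtain ⟨p, rfl, hp, hpc⟩ := hP
  exact ⟨p, rfl, hp.trans h.le, by rw [coeff_eq_zero_of_natDegree_lt (hp.trans_lt h), C_0]⟩

lemma hasLead_algebraMap (c : ℂ) : HasLead (algebraMap ℂ _ c) 0 c :=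
  ⟨monomial 0 (C c), by rw [op_monomial, mulP_C, pow_zero, mul_one], natDegree_monomial_le _, by
    rw [coeff_monomial, if_pos rfl]⟩

lemma hasLead_Wd : HasLead Wd 1 1 :=
  ⟨monomial 1 1, by rw [op_monomial, mulP_one, one_mul, pow_one], natDegree_monomial_le _, by
    rw [coeff_monomial, if_pos rfl, C_1]⟩

lemma HasLead.smul {P : Module.End ℂ ℂ[X]} {k : ℕ} {c : ℂ} (hP : HasLead P k c) (z : ℂ) :
    HasLead (z • P) k (z * c) := by
  simpa [Algebra.smul_def] using (hasLead_algebraMap z).mul hP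

lemma HasLead.sub {P Q : Module.End ℂ ℂ[X]} {k : ℕ} {c d : ℂ} (hP : HasLead P k c)
    (hQ : HasLead Q k d) : HasLead (P - Q) k (c - d) := by
  have h : P - Q = P + (-1 : ℂ) • Q := LinearMap.ext fun f => by simp [sub_eq_add_neg]
  rw [h, sub_eq_add_neg, ← neg_one_mul d]
  exact hP.add (hQ.smul (-1))

lemma HasLead.pow {P : Module.End ℂ ℂ[X]} {k : ℕ} (hP : HasLead P k 1) (n : ℕ) :
    HasLead (P ^ n) (k * n) 1 := by
  induction n with
  | zero => simpa using hasLead_algebraMap 1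
  | succ n ih => simpa [pow_succ, mul_add] using ih.mul hP

lemma HasLead.aeval {P : Module.End ℂ ℂ[X]} {k : ℕ} (hP : HasLead P k 1) (hk : 0 < k)
    (f : ℂ[X]) : HasLead (aeval P f) (k * f.natDegree) f.leadingCoeff := by
  have h : ∀ n, f.natDegree ≤ n → HasLead (Polynomial.aeval P f) (k * n) (f.coeff n) := by
    intro n hn
    induction n generalizing f with
    | zero =>
      rw [eq_C_of_natDegree_le_zero hn, aeval_C, coeff_C_zero]
      exact hasLead_algebraMap _
    | succ n ih =>
      have hdecomp : f = (f - monomial (n + 1) (f.coeff (n + 1))) +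
          monomial (n + 1) (f.coeff (n + 1)) := by ring
      have hdeg : (f - monomial (n + 1) (f.coeff (n + 1))).natDegree ≤ n := by
        rw [natDegree_le_iff_coeff_eq_zero]
        intro j hj
        rw [coeff_sub, coeff_monomial]
        split_ifs with hj'
        · rw [hj', sub_self]
        · rw [sub_zero]
          exact coeff_eq_zero_of_natDegree_lt (by omega)
      have h1 := (ih _ hdeg).of_lt (Nat.mul_lt_mul_of_pos_left (Nat.lt_succ_self n) hk)
      have h2 := h1.add ((hP.pow (n + 1)).smul (f.coeff (n + 1)))
      rw [zero_add, mul_one] at h2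
      have heq : Polynomial.aeval P f = Polynomial.aeval P (f - monomial (n + 1) (f.coeff (n + 1)))
          + f.coeff (n + 1) • P ^ (n + 1) := by
        conv_lhs => rw [hdecomp]
        rw [map_add, aeval_monomial, Algebra.smul_def]
      rw [heq]
      exact h2
  exact h _ le_rfl

lemma HasLead.ordW {P : Module.End ℂ ℂ[X]} {k : ℕ} {c : ℂ} (hP : HasLead P k c) (hc : c ≠ 0) :
    OrdW P k := by
  obtain ⟨p, rfl, hp, hpc⟩ := hP
  have hne : p.coeff k ≠ 0 := by rw [hpc]; exact C_ne_zero.2 hc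
  exact (ordW_iff _ _).2 ⟨p, rfl, fun h => hne (by rw [h, coeff_zero]),
    le_antisymm (le_natDegree_of_ne_zero hne) hp⟩

lemma ordW_unique {P : Module.End ℂ ℂ[X]} {k l : ℕ} (hk : OrdW P k) (hl : OrdW P l) : k = l := by
  obtain ⟨p, rfl, -, rfl⟩ := (ordW_iff _ _).1 hk
  obtain ⟨q, hq, -, rfl⟩ := (ordW_iff _ _).1 hl
  rw [op_injective hq]

lemma ne_zero_of_ordW {P : Module.End ℂ ℂ[X]} {k : ℕ} (hk : OrdW P k) : P ≠ 0 := by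
  obtain ⟨p, rfl, hp, -⟩ := (ordW_iff _ _).1 hk
  exact (map_ne_zero_iff _ op_injective).2 hp

/-- The leading coefficient of an operator commuting with a monic operator is constant. -/
lemma derivative_leadingCoeff_eq_zero {p q : ℂ[X][X]} (hp : p.Monic) (hp0 : 0 < p.natDegree)
    (h : op p * op q = op q * op p) :
    derivative q.leadingCoeff = 0 := by
  have hsum := sum_commutator_eq_zero h (K := p.natDegree + q.natDegree + 2) (by omega) (by omega)
  obtain ⟨d, hd⟩ : ∃ d, p.natDegree = d + 1 := ⟨_, (Nat.succ_pred_eq_of_pos hp0).symm⟩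
  have hdX : (derivX p).natDegree ≤ d := by
    rw [natDegree_le_iff_coeff_eq_zero]
    intro j hj
    rcases (Nat.succ_le_of_lt hj).eq_or_lt with rfl | hj
    · have := hp.coeff_natDegree
      rw [hd] at this
      rw [coeff_derivX, Nat.succ_eq_add_one, this, derivative_one]
    · rw [coeff_derivX, coeff_eq_zero_of_natDegree_lt (by omega), derivative_zero]
  have hc := congrArg (fun r : ℂ[X][X] => r.coeff (d + q.natDegree)) hsum
  simp only [finsetSum_coeff, coeff_zero] at hc
  rw [Finset.sum_eq_single 1] at hc
  · have h1 : (hasseDeriv 1 p * derivX q).coeff (d + q.natDegree) =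
        (d + 1 : ℂ[X]) * derivative q.leadingCoeff := by
      rw [coeff_mul_add_eq_of_natDegree_le ((natDegree_hasseDeriv_le p 1).trans (by omega))
        (by simpa using natDegree_derivX_pow_le q 1), coeff_derivX, hasseDeriv_coeff]
      have := hp.coeff_natDegree
      rw [hd] at this
      simp [this]
    have h2 : (hasseDeriv 1 q * derivX p).coeff (d + q.natDegree) = 0 := by
      by_cases hq0 : q.natDegree = 0
      · rw [hasseDeriv_one, derivative_of_natDegree_zero hq0, zero_mul, coeff_zero]
      · apply coeff_eq_zero_of_natDegree_lt
        have := natDegree_mul_le_of_le (natDegree_hasseDeriv_le q 1) hdX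
        omega
    rw [pow_one, coeff_sub, h1, h2, sub_zero] at hc
    refine (mul_eq_zero.1 hc).resolve_left ?_
    exact_mod_cast Nat.succ_ne_zero d
  · intro k _ hk1
    rcases Nat.eq_zero_or_pos k with rfl | hk
    · simp [mul_comm]
    · have h1 := natDegree_mul_le_of_le (natDegree_hasseDeriv_le p k)
        (natDegree_derivX_pow_le q k)
      have h2 : ((derivX ^ k) p).natDegree ≤ d := by
        obtain ⟨e, rfl⟩ : ∃ e, k = e + 1 := ⟨k - 1, by omega⟩
        rw [pow_succ, Module.End.mul_apply]
        exact (natDegree_derivX_pow_le _ _).trans hdX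
      have h3 : (hasseDeriv k q * (derivX ^ k) p).coeff (d + q.natDegree) = 0 := by
        by_cases hkq : q.natDegree < k
        · rw [hasseDeriv_eq_zero_of_lt_natDegree _ _ hkq, zero_mul, coeff_zero]
        · apply coeff_eq_zero_of_natDegree_lt
          have := natDegree_mul_le_of_le (natDegree_hasseDeriv_le q k) h2
          omega
      have h4 : (hasseDeriv k p * (derivX ^ k) q).coeff (d + q.natDegree) = 0 := by
        by_cases hkp : p.natDegree < k
        · rw [hasseDeriv_eq_zero_of_lt_natDegree _ _ hkp, zero_mul, coeff_zero]
        · exact coeff_eq_zero_of_natDegree_lt (by omega)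
      rw [coeff_sub, h3, h4, sub_zero]
  · intro h1
    simp at h1

/-- All monomials `x^i Y^j` of `p` have weight `ρ i + σ j` at most `N`. -/
def WeightLE (ρ σ : ℕ) (p : ℂ[X][X]) (N : ℤ) : Prop :=
  ∀ i j, (p.coeff j).coeff i ≠ 0 → (ρ * i + σ * j : ℤ) ≤ N

lemma WeightLE.mul {ρ σ : ℕ} {p q : ℂ[X][X]} {M N : ℤ} (hp : WeightLE ρ σ p M)
    (hq : WeightLE ρ σ q N) : WeightLE ρ σ (p * q) (M + N) := by
  intro i j h
  rw [coeff_mul, finsetSum_coeff] at h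
  obtain ⟨⟨j₁, j₂⟩, hj, h⟩ := Finset.exists_ne_zero_of_sum_ne_zero h
  rw [coeff_mul] at h
  obtain ⟨⟨i₁, i₂⟩, hi, h⟩ := Finset.exists_ne_zero_of_sum_ne_zero h
  rw [Finset.HasAntidiagonal.mem_antidiagonal] at hi hj
  have h1 := hp _ _ (left_ne_zero_of_mul h)
  have h2 := hq _ _ (right_ne_zero_of_mul h)
  simp only at hi hj h1 h2
  rw [← hi, ← hj]
  push_cast
  linarith

lemma WeightLE.hasseDeriv {ρ σ : ℕ} {p : ℂ[X][X]} {N : ℤ} (hp : WeightLE ρ σ p N) (k : ℕ) :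
    WeightLE ρ σ (hasseDeriv k p) (N - σ * k) := by
  intro i j h
  rw [hasseDeriv_coeff, ← C_eq_natCast, coeff_C_mul] at h
  have := hp _ _ (right_ne_zero_of_mul h)
  push_cast at this
  linarith

lemma WeightLE.derivX_pow {ρ σ : ℕ} {p : ℂ[X][X]} {N : ℤ} (hp : WeightLE ρ σ p N) (k : ℕ) :
    WeightLE ρ σ ((derivX ^ k) p) (N - ρ * k) := by
  intro i j h
  rw [coeff_derivX_pow, coeff_iterate_derivative] at h
  have := hp _ _ (fun h0 => h (by rw [h0, smul_zero]))
  push_cast at this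
  linarith

lemma WeightLE.C_X_mul_X (ρ σ : ℕ) : WeightLE ρ σ (C X * X) (ρ + σ) := by
  intro i j h
  rw [coeff_C_mul, coeff_X] at h
  split_ifs at h with hj
  · rw [mul_one, coeff_X] at h
    split_ifs at h with hi
    · rw [← hi, ← hj]; simp
    · exact absurd rfl h
  · simp at h

/-- The substitution `x ↦ T^ρ`, `Y ↦ Y T^σ`; its coefficient at `T^N` is the dehomogenized weight
`N` component. -/
noncomputable def weightHom (ρ σ : ℕ) : ℂ[X][X] →+* ℂ[X][X] :=
  eval₂RingHom (eval₂RingHom ((C : ℂ[X] →+* ℂ[X][X]).comp C) (X ^ ρ)) (C X * X ^ σ)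

lemma weightHom_monomial (ρ σ i j : ℕ) (z : ℂ) :
    weightHom ρ σ (monomial j (monomial i z)) = monomial (ρ * i + σ * j) (monomial j z) := by
  simp only [weightHom, coe_eval₂RingHom, eval₂_monomial, RingHom.comp_apply]
  rw [← C_mul_X_pow_eq_monomial, ← C_mul_X_pow_eq_monomial]
  simp only [map_mul, map_pow, pow_add, pow_mul, mul_pow]
  ring

lemma coeff_weightHom {ρ : ℕ} (σ : ℕ) (hρ : 0 < ρ) (p : ℂ[X][X]) (i j : ℕ) :
    ((weightHom ρ σ p).coeff (ρ * i + σ * j)).coeff j = (p.coeff j).coeff i := by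
  induction p using bivariate_induction with
  | add p q hp hq => simp only [map_add, coeff_add, hp, hq]
  | mon a b z =>
    rw [weightHom_monomial, coeff_monomial, coeff_monomial]
    by_cases hb : b = j
    · subst hb
      by_cases ha : a = i
      · simp [ha]
      · have : ¬ (ρ * a + σ * b = ρ * i + σ * b) := fun h =>
          ha (Nat.eq_of_mul_eq_mul_left hρ (Nat.add_right_cancel h))
        rw [if_neg this, if_pos rfl, coeff_monomial, if_neg ha, coeff_zero]
    · rw [if_neg hb]
      split_ifs <;> simp [coeff_monomial, hb]

lemma coeff_weightHom_eq_zero {ρ σ N j : ℕ} (p : ℂ[X][X]) (h : ∀ i, ρ * i + σ * j ≠ N) :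
    ((weightHom ρ σ p).coeff N).coeff j = 0 := by
  induction p using bivariate_induction with
  | add p q hp hq => simp only [map_add, coeff_add, hp, hq, add_zero]
  | mon a b z =>
    rw [weightHom_monomial, coeff_monomial]
    split_ifs with hN
    · rw [coeff_monomial, if_neg]
      rintro rfl
      exact h _ hN
    · simp

lemma exists_coeff_ne_zero_of_weightHom {ρ σ N j : ℕ} (hρ : 0 < ρ) {p : ℂ[X][X]}
    (h : ((weightHom ρ σ p).coeff N).coeff j ≠ 0) :
    ∃ i, ρ * i + σ * j = N ∧ (p.coeff j).coeff i ≠ 0 := by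
  by_contra! hcon
  by_cases hi : ∃ i, ρ * i + σ * j = N
  · obtain ⟨i, rfl⟩ := hi
    rw [coeff_weightHom σ hρ] at h
    exact h (hcon i rfl)
  · push Not at hi
    exact h (coeff_weightHom_eq_zero p hi)

lemma WeightLE.coeff_weightHom_eq_zero {ρ σ N : ℕ} (hρ : 0 < ρ) {p : ℂ[X][X]} {M : ℤ}
    (hp : WeightLE ρ σ p M) (h : M < N) : (weightHom ρ σ p).coeff N = 0 := by
  ext j
  by_contra hne
  obtain ⟨i, rfl, hi⟩ := exists_coeff_ne_zero_of_weightHom hρ hne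
  have := hp i j hi
  push_cast at h
  linarith

lemma WeightLE.natDegree_weightHom_le {ρ σ N : ℕ} (hρ : 0 < ρ) {p : ℂ[X][X]}
    (hp : WeightLE ρ σ p N) : (weightHom ρ σ p).natDegree ≤ N :=
  natDegree_le_iff_coeff_eq_zero.2 fun M hM =>
    hp.coeff_weightHom_eq_zero hρ (by exact_mod_cast hM)

lemma weightLE_natDegree_weightHom {ρ : ℕ} (σ : ℕ) (hρ : 0 < ρ) (p : ℂ[X][X]) :
    WeightLE ρ σ p (weightHom ρ σ p).natDegree := by
  intro i j h
  rw [← coeff_weightHom σ hρ] at h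
  exact_mod_cast le_natDegree_of_ne_zero fun h0 => h (by rw [h0, coeff_zero])

lemma X_mul_derivative_monomial {R : Type*} [CommSemiring R] (n : ℕ) (a : R) :
    X * derivative (monomial n a) = (n : R[X]) * monomial n a := by
  rw [derivative_monomial]
  cases n with
  | zero => simp
  | succ n => rw [X_mul_monomial, Nat.add_sub_cancel, mul_comm a, ← C_eq_natCast, C_mul_monomial]

lemma coeff_weightHom_X_mul_derivative (ρ σ N : ℕ) (p : ℂ[X][X]) :
    (weightHom ρ σ (X * derivative p)).coeff N =
      X * derivative ((weightHom ρ σ p).coeff N) := by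
  induction p using bivariate_induction with
  | add p q hp hq => simp only [map_add, mul_add, coeff_add, hp, hq]
  | mon i j z =>
    rw [X_mul_derivative_monomial, map_mul, map_natCast, weightHom_monomial, ← C_eq_natCast,
      coeff_C_mul, coeff_monomial]
    split_ifs
    · rw [X_mul_derivative_monomial]
    · simp

lemma coeff_weightHom_C_X_mul_derivX (ρ σ N : ℕ) (p : ℂ[X][X]) :
    (ρ : ℂ[X]) * (weightHom ρ σ (C X * derivX p)).coeff N =
      (N : ℂ[X]) * (weightHom ρ σ p).coeff N -
        (σ : ℂ[X]) * (X * derivative ((weightHom ρ σ p).coeff N)) := by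
  induction p using bivariate_induction with
  | add p q hp hq => simp only [map_add, mul_add, coeff_add, hp, hq]; ring
  | mon i j z =>
    rw [derivX_monomial, C_mul_monomial, X_mul_derivative_monomial, ← C_mul_monomial, map_mul,
      C_eq_natCast, map_natCast, weightHom_monomial, ← C_eq_natCast (R := ℂ[X]) i, coeff_C_mul,
      coeff_monomial]
    split_ifs with h
    · rw [X_mul_derivative_monomial, ← h]
      push_cast
      ring
    · simp

/-- The weighted leading forms of commuting operators Poisson commute. -/
lemma leadingForm_relation {ρ σ M N : ℕ} (hρ : 0 < ρ) {p q : ℂ[X][X]}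
    (hp : WeightLE ρ σ p M) (hq : WeightLE ρ σ q N) (h : op p * op q = op q * op p) :
    (N : ℂ[X]) * derivative ((weightHom ρ σ p).coeff M) * (weightHom ρ σ q).coeff N =
      (M : ℂ[X]) * (weightHom ρ σ p).coeff M * derivative ((weightHom ρ σ q).coeff N) := by
  have hprod : ∀ {p q : ℂ[X][X]} {M N : ℕ}, WeightLE ρ σ p M → WeightLE ρ σ q N →
      (ρ : ℂ[X]) * (weightHom ρ σ (C X * X * (hasseDeriv 1 p * (derivX ^ 1) q))).coeff (M + N) =
      X * derivative ((weightHom ρ σ p).coeff M) *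
        ((N : ℂ[X]) * (weightHom ρ σ q).coeff N -
          (σ : ℂ[X]) * (X * derivative ((weightHom ρ σ q).coeff N))) := by
    intro p q M N hp hq
    have hp' : WeightLE ρ σ (X * derivative p) M := by
      intro i j hij
      cases j with
      | zero => simp at hij
      | succ j =>
        rw [coeff_X_mul, coeff_derivative] at hij
        refine hp _ _ fun h0 => hij ?_
        have : ((j : ℂ[X]) + 1) = C ((j : ℂ) + 1) := by simp
        rw [this, coeff_mul_C, h0, zero_mul]
    have hq' : WeightLE ρ σ (C X * derivX q) N := by
      intro i j hij
      rw [coeff_C_mul, coeff_derivX] at hij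
      cases i with
      | zero => simp at hij
      | succ i =>
        rw [coeff_X_mul, coeff_derivative] at hij
        exact hq _ _ (left_ne_zero_of_mul hij)
    rw [← coeff_weightHom_C_X_mul_derivX, ← coeff_weightHom_X_mul_derivative, pow_one,
      hasseDeriv_one, show C X * X * (derivative p * derivX q) =
        (X * derivative p) * (C X * derivX q) by ring, map_mul,
      coeff_mul_add_eq_of_natDegree_le (hp'.natDegree_weightHom_le hρ)
        (hq'.natDegree_weightHom_le hρ)]
    ring
  have hlow : ∀ {p q : ℂ[X][X]} {M N : ℕ}, WeightLE ρ σ p M → WeightLE ρ σ q N → ∀ k, 1 < k →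
      (weightHom ρ σ (C X * X * (hasseDeriv k p * (derivX ^ k) q))).coeff (M + N) = 0 := by
    intro p q M N hp hq k hk
    refine ((WeightLE.C_X_mul_X ρ σ).mul ((hp.hasseDeriv k).mul (hq.derivX_pow k))
      ).coeff_weightHom_eq_zero hρ ?_
    push_cast
    have hk' : (1 : ℤ) < k := by exact_mod_cast hk
    have hρ' : (0 : ℤ) < ρ := by exact_mod_cast hρ
    nlinarith [mul_pos hρ' (sub_pos.2 hk'),
      mul_nonneg (Int.natCast_nonneg σ) (sub_pos.2 hk').le]
  have hsum := sum_commutator_eq_zero h (K := p.natDegree + q.natDegree + 2) (by omega) (by omega)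
  have hc := congrArg (fun r => (weightHom ρ σ (C X * X * r)).coeff (M + N)) hsum
  simp only [Finset.mul_sum, map_sum, finsetSum_coeff, mul_zero, map_zero, coeff_zero] at hc
  rw [Finset.sum_eq_single 1] at hc
  · have h1 := hprod hp hq
    have h2 := hprod hq hp
    rw [mul_sub, map_sub, coeff_sub, sub_eq_zero] at hc
    rw [add_comm N M, ← hc, h1] at h2
    refine mul_left_cancel₀ (X_ne_zero (R := ℂ)) ?_
    linear_combination h2
  · intro k _ hk1
    rcases Nat.eq_zero_or_pos k with rfl | hk
    · rw [hasseDeriv_zero', hasseDeriv_zero', pow_zero, Module.End.one_apply,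
        Module.End.one_apply, mul_comm q p, sub_self, mul_zero, map_zero, coeff_zero]
    · rw [mul_sub, map_sub, coeff_sub, hlow hp hq k (by omega), add_comm,
        hlow hq hp k (by omega), sub_zero]
  · intro h1
    simp at h1

lemma natDegree_mul_eq_of_derivative_relation {a b : ℕ} {f g : ℂ[X]} (hf : f ≠ 0) (hg : g ≠ 0)
    (h : (a : ℂ[X]) * derivative f * g = (b : ℂ[X]) * f * derivative g) :
    a * f.natDegree = b * g.natDegree := by
  have key : ∀ {f g : ℂ[X]}, (X * derivative f * g).coeff (f.natDegree + g.natDegree) =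
      f.natDegree * (f.leadingCoeff * g.leadingCoeff) := by
    intro f g
    have hle : (X * derivative f).natDegree ≤ f.natDegree := by
      by_cases h0 : f.natDegree = 0
      · simp [derivative_of_natDegree_zero h0]
      · have := natDegree_mul_le_of_le (natDegree_X_le (R := ℂ)) (natDegree_derivative_le f)
        omega
    rw [coeff_mul_add_eq_of_natDegree_le hle le_rfl]
    cases hn : f.natDegree with
    | zero => simp
    | succ n =>
      rw [coeff_X_mul, coeff_derivative, ← hn]
      have : (f.natDegree : ℂ) = n + 1 := by rw [hn]; push_cast; ring
      rw [leadingCoeff, leadingCoeff, this, hn]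
      ring
  have hl := key (f := f) (g := g)
  have hr := key (f := g) (g := f)
  have h' : C (a : ℂ) * (X * derivative f * g) = C (b : ℂ) * (X * derivative g * f) := by
    simp only [map_natCast]
    linear_combination X * h
  have hc := congrArg (fun r => r.coeff (f.natDegree + g.natDegree)) h'
  simp only [coeff_C_mul] at hc
  rw [hl, add_comm, hr] at hc
  have hne : f.leadingCoeff * g.leadingCoeff ≠ 0 :=
    mul_ne_zero (leadingCoeff_ne_zero.2 hf) (leadingCoeff_ne_zero.2 hg)
  have : (a * f.natDegree : ℂ) = b * g.natDegree :=
    mul_right_cancel₀ hne (by linear_combination hc)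
  exact_mod_cast this

/-- Two polynomials with the same logarithmic derivative are proportional. -/
lemma exists_eq_C_mul_of_derivative_relation {f g : ℂ[X]} (hf : f ≠ 0) (hg : g ≠ 0)
    (h : derivative f * g = f * derivative g) : ∃ c, c ≠ 0 ∧ f = C c * g := by
  have hdeg : f.natDegree = g.natDegree := by
    simpa using natDegree_mul_eq_of_derivative_relation (a := 1) (b := 1) hf hg (by simpa using h)
  refine ⟨f.leadingCoeff / g.leadingCoeff,
    div_ne_zero (leadingCoeff_ne_zero.2 hf) (leadingCoeff_ne_zero.2 hg), ?_⟩
  by_contra hne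
  set c := f.leadingCoeff / g.leadingCoeff with hcdef
  have hr : f - C c * g ≠ 0 := sub_ne_zero.2 hne
  have hrel : derivative (f - C c * g) * g = (f - C c * g) * derivative g := by
    simp only [derivative_sub, derivative_C_mul]
    linear_combination h
  have hdeg' : (f - C c * g).natDegree = g.natDegree := by
    simpa using natDegree_mul_eq_of_derivative_relation (a := 1) (b := 1) hr hg
      (by simpa using hrel)
  apply leadingCoeff_ne_zero.2 hr
  rw [leadingCoeff, hdeg', coeff_sub, coeff_C_mul, coeff_natDegree, ← hdeg, coeff_natDegree,
    hcdef, div_mul_cancel₀ _ (leadingCoeff_ne_zero.2 hg), sub_self]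

/-- A depressed monic quartic some odd power of which is, up to a constant, a fourth power. -/
lemma eq_X_pow_four_of_pow_eq {f g : ℂ[X]} {m : ℕ} (hm : m % 2 = 1) (hf : f.Monic)
    (hdeg : f.natDegree = 4) (h3 : f.coeff 3 = 0) {c : ℂ} (hc : c ≠ 0)
    (h : f ^ m = C c * g ^ 4) : f = X ^ 4 := by
  obtain ⟨r, hr⟩ := Complex.exists_root (f := f) (by
    rw [degree_eq_natDegree hf.ne_zero, hdeg]; norm_num)
  have hmult : m * f.roots.count r = 4 * g.roots.count r := by
    have := congrArg (fun s => s.roots.count r) h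
    simpa [roots_pow, roots_C_mul _ hc] using this
  have hpos : 0 < f.roots.count r := by
    rw [count_roots]
    exact (rootMultiplicity_pos hf.ne_zero).2 hr
  have hdvd : 4 ∣ f.roots.count r :=
    (Nat.Coprime.pow_left 2 (Nat.coprime_two_left.2 (Nat.odd_iff.2 hm))).dvd_of_dvd_mul_left
      (show 2 ^ 2 ∣ _ from ⟨_, hmult⟩)
  have hpow : (X - C r) ^ 4 ∣ f := by
    rw [← le_rootMultiplicity_iff hf.ne_zero, ← count_roots]
    exact Nat.le_of_dvd hpos hdvd
  have heq : f = (X - C r) ^ 4 := by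
    refine (eq_of_monic_of_dvd_of_natDegree_le ((monic_X_sub_C r).pow 4) hf hpow ?_)
    rw [hdeg, natDegree_pow, natDegree_X_sub_C]
  have hr0 : r = 0 := by
    rw [heq, show (X - C r) ^ 4 = X ^ 4 - C (4 * r) * X ^ 3 + C (6 * r ^ 2) * X ^ 2 -
      C (4 * r ^ 3) * X + C (r ^ 4) by simp only [map_mul, map_pow, map_ofNat]; ring] at h3
    simp only [coeff_add, coeff_sub, coeff_C_mul, coeff_X_pow, coeff_X, coeff_C] at h3
    simpa using h3
  rw [heq, hr0, C_0, sub_zero]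

/-- An operator commuting with a monic nonconstant-coefficient operator of order four without
`∂³`-term has even order. -/
lemma even_natDegree_of_commute {p q : ℂ[X][X]} (hp : p.Monic) (hp4 : p.natDegree = 4)
    (hp3 : p.coeff 3 = 0) (hnc : ∃ j, 0 < (p.coeff j).natDegree) (hq : q ≠ 0)
    (h : op p * op q = op q * op p) : q.natDegree % 2 = 0 := by
  have hlc : p.coeff 4 = 1 := by rw [← hp4]; exact hp.coeff_natDegree
  have hsmall : ∀ j, 0 < (p.coeff j).natDegree → j < 3 := by
    intro j hj
    by_contra! hj3
    rcases hj3.eq_or_lt with rfl | hj4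
    · simp [hp3] at hj
    · rcases (Nat.succ_le_of_lt hj4).eq_or_lt with rfl | hj5
      · simp [hlc] at hj
      · rw [coeff_eq_zero_of_natDegree_lt (by omega)] at hj
        simp at hj
  obtain ⟨j₀, hj₀, hmax⟩ := Finset.exists_max_image (Finset.range 3)
    (fun j => ((p.coeff j).natDegree : ℚ) / (4 - j)) ⟨0, by simp⟩
  rw [Finset.mem_range] at hj₀
  have hpos4 : ∀ j : ℕ, j < 3 → (0 : ℚ) < 4 - j := by
    intro j hj
    have : (j : ℚ) < 3 := by exact_mod_cast hj
    linarith
  have hmax' : ∀ j < 3, (4 - j₀) * (p.coeff j).natDegree + (p.coeff j₀).natDegree * j ≤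
      4 * (p.coeff j₀).natDegree := by
    intro j hj
    have h1 := hmax j (Finset.mem_range.2 hj)
    rw [div_le_div_iff₀ (hpos4 j hj) (hpos4 j₀ hj₀)] at h1
    have hcast : ((4 - j₀ : ℕ) : ℚ) = 4 - j₀ := by
      rw [Nat.cast_sub (by omega)]; norm_num
    have : (((4 - j₀ : ℕ) * (p.coeff j).natDegree + (p.coeff j₀).natDegree * j : ℕ) : ℚ) ≤
        ((4 * (p.coeff j₀).natDegree : ℕ) : ℚ) := by
      push_cast [hcast]
      linarith
    exact_mod_cast this
  have hσ : 0 < (p.coeff j₀).natDegree := by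
    obtain ⟨j, hj⟩ := hnc
    have hj3 := hsmall j hj
    have h1 := hmax' j hj3
    have h2 : 0 < (4 - j₀) * (p.coeff j).natDegree := Nat.mul_pos (by omega) hj
    omega
  obtain ⟨σ, hσdef⟩ : ∃ σ, σ = (p.coeff j₀).natDegree := ⟨_, rfl⟩
  obtain ⟨ρ, hρdef⟩ : ∃ ρ, ρ = 4 - j₀ := ⟨_, rfl⟩
  rw [← hσdef] at hσ hmax'
  rw [← hρdef] at hmax'
  have hρ : 0 < ρ := by omega
  have hW : WeightLE ρ σ p (4 * σ : ℕ) := by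
    intro i j hij
    have hi := le_natDegree_of_ne_zero hij
    have : ρ * i + σ * j ≤ 4 * σ := by
      by_cases hj : j < 3
      · exact (Nat.add_le_add_right (Nat.mul_le_mul_left ρ hi) _).trans (hmax' j hj)
      · have hi0 : i = 0 := by
          by_contra hi0
          exact hj (hsmall j (by omega))
        have hj4 : j ≤ 4 := hp4 ▸ le_natDegree_of_ne_zero fun h0 => hij (by rw [h0, coeff_zero])
        rw [hi0, mul_zero, zero_add, mul_comm]
        exact Nat.mul_le_mul_right σ hj4
    exact_mod_cast this
  obtain ⟨F, hF⟩ : ∃ F, F = (weightHom ρ σ p).coeff (4 * σ) := ⟨_, rfl⟩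
  obtain ⟨n, hn⟩ : ∃ n, n = (weightHom ρ σ q).natDegree := ⟨_, rfl⟩
  obtain ⟨G, hG⟩ : ∃ G, G = (weightHom ρ σ q).coeff n := ⟨_, rfl⟩
  have hrel := leadingForm_relation hρ hW (hn ▸ weightLE_natDegree_weightHom σ hρ q) h
  rw [← hF, ← hG] at hrel
  have hF4 : F.coeff 4 = 1 := by
    have := coeff_weightHom σ hρ p 0 4
    rwa [mul_zero, zero_add, mul_comm σ, ← hF, hlc, coeff_one_zero] at this
  have hF_coeff : ∀ j, p.coeff j = 0 → F.coeff j = 0 := by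
    intro j hj
    by_contra hne
    rw [hF] at hne
    obtain ⟨i, -, hi⟩ := exists_coeff_ne_zero_of_weightHom hρ hne
    exact hi (by rw [hj, coeff_zero])
  have hFdeg : F.natDegree = 4 := by
    refine le_antisymm (natDegree_le_iff_coeff_eq_zero.2 fun j hj => ?_)
      (le_natDegree_of_ne_zero (by rw [hF4]; exact one_ne_zero))
    exact hF_coeff j (coeff_eq_zero_of_natDegree_lt (by omega))
  have hFmonic : F.Monic := by rw [Monic, leadingCoeff, hFdeg, hF4]
  have hFj₀ : F.coeff j₀ ≠ 0 := by
    have := coeff_weightHom σ hρ p σ j₀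
    rw [show ρ * σ + σ * j₀ = 4 * σ by
      rw [mul_comm σ, ← add_mul]; congr 1; omega, ← hF] at this
    rw [this, hσdef, coeff_natDegree, Ne, leadingCoeff_eq_zero]
    intro h0
    rw [h0, natDegree_zero] at hσdef
    omega
  have hFne : F ≠ X ^ 4 := fun hX => hFj₀ (by rw [hX, coeff_X_pow, if_neg (by omega)])
  have hconst := derivative_leadingCoeff_eq_zero hp (by omega) h
  have hlead : (q.coeff q.natDegree).coeff 0 ≠ 0 := by
    rw [coeff_natDegree]
    intro h0
    apply leadingCoeff_ne_zero.2 hq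
    rw [eq_C_of_derivative_eq_zero hconst, h0, C_0]
  have hnge : σ * q.natDegree ≤ n := by
    have := weightLE_natDegree_weightHom σ hρ q 0 q.natDegree hlead
    rw [← hn] at this
    simpa using (by exact_mod_cast this : ρ * 0 + σ * q.natDegree ≤ n)
  have hGne : G ≠ 0 := by
    rw [hG, hn, coeff_natDegree, Ne, leadingCoeff_eq_zero]
    intro h0
    rw [← coeff_weightHom σ hρ, h0] at hlead
    simp at hlead
  have hGdeg_le : G.natDegree ≤ q.natDegree := by
    rw [natDegree_le_iff_coeff_eq_zero]
    intro j hj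
    by_contra hne
    rw [hG] at hne
    obtain ⟨i, -, hi⟩ := exists_coeff_ne_zero_of_weightHom hρ hne
    exact hi (by rw [coeff_eq_zero_of_natDegree_lt hj, coeff_zero])
  have hnG := natDegree_mul_eq_of_derivative_relation hFmonic.ne_zero hGne hrel
  rw [hFdeg] at hnG
  have hn' : n = σ * q.natDegree := by
    have := Nat.mul_le_mul_left σ hGdeg_le
    nlinarith
  by_contra hodd
  have hm : q.natDegree % 2 = 1 := by omega
  have hrel' : (q.natDegree : ℂ[X]) * derivative F * G = 4 * F * derivative G := by
    have hσ' : (σ : ℂ[X]) ≠ 0 := by exact_mod_cast hσ.ne'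
    rw [hn'] at hrel
    push_cast at hrel
    refine mul_left_cancel₀ hσ' ?_
    linear_combination hrel
  obtain ⟨m, hm'⟩ : ∃ m, q.natDegree = m + 1 := ⟨q.natDegree - 1, by omega⟩
  obtain ⟨c, hc, hpow⟩ := exists_eq_C_mul_of_derivative_relation
    (f := F ^ q.natDegree) (g := G ^ 4) (pow_ne_zero _ hFmonic.ne_zero) (pow_ne_zero _ hGne) (by
      rw [hm'] at hrel' ⊢
      rw [derivative_pow, derivative_pow, Nat.add_sub_cancel]
      push_cast at hrel' ⊢
      simp only [map_add, map_natCast, map_one, map_ofNat]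
      linear_combination F ^ m * G ^ 3 * hrel')
  exact hFne (eq_X_pow_four_of_pow_eq hm hFmonic hFdeg
    (hF_coeff 3 hp3) hc hpow)

lemma op_map_C (f : ℂ[X]) : op (f.map C) = aeval Wd f := by
  induction f using Polynomial.induction_on' with
  | add f g hf hg => simp only [Polynomial.map_add, map_add, hf, hg]
  | monomial n z => rw [map_monomial, op_monomial, mulP_C, aeval_monomial]

lemma not_irreducibleOp_aeval {A : Module.End ℂ ℂ[X]} {a : ℕ} (hA : HasLead A a 1) (ha : 0 < a)
    {f : ℂ[X]} (hf : 2 ≤ f.natDegree) : ¬ IrreducibleOp (aeval A f) := by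
  have hf0 : f ≠ 0 := fun h => by simp [h] at hf
  obtain ⟨r, hr⟩ := Complex.exists_root (f := f) (natDegree_pos_iff_degree_pos.1 (by omega))
  obtain ⟨g, rfl⟩ := dvd_iff_isRoot.2 hr
  have hg0 : g ≠ 0 := right_ne_zero_of_mul hf0
  rw [natDegree_mul (X_sub_C_ne_zero r) hg0, natDegree_X_sub_C] at hf
  have hord : ∀ {h : ℂ[X]}, h ≠ 0 → 0 < h.natDegree →
      InWeyl (aeval A h) ∧ ∃ k, 0 < k ∧ OrdW (aeval A h) k := by
    intro h hh hpos
    have hl := hA.aeval ha h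
    have ho := hl.ordW (leadingCoeff_ne_zero.2 hh)
    obtain ⟨q, hq, -⟩ := hl
    exact ⟨(inWeyl_iff _).2 ⟨q, hq⟩, _, Nat.mul_pos ha hpos, ho⟩
  obtain ⟨h1, h2⟩ := hord (X_sub_C_ne_zero r) (by rw [natDegree_X_sub_C]; exact one_pos)
  obtain ⟨h3, h4⟩ := hord hg0 (by omega)
  exact fun hirr => hirr ⟨_, _, h1, h3, h2, h4, map_mul _ _ _⟩

lemma inWeyl_mul {P Q : Module.End ℂ ℂ[X]} (hP : InWeyl P) (hQ : InWeyl Q) : InWeyl (P * Q) := by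
  obtain ⟨p, rfl⟩ := (inWeyl_iff _).1 hP
  obtain ⟨q, rfl⟩ := (inWeyl_iff _).1 hQ
  exact (inWeyl_iff _).2 ⟨_, op_mul_op p q (Nat.lt_succ_self _)⟩

lemma HasLead.inWeyl {P : Module.End ℂ ℂ[X]} {k : ℕ} {c : ℂ} (h : HasLead P k c) : InWeyl P := by
  obtain ⟨p, hp, -⟩ := h
  exact (inWeyl_iff _).2 ⟨p, hp⟩

lemma HasLead.lt_of_zero {P : Module.End ℂ ℂ[X]} {k l : ℕ} (h : HasLead P k 0) (hl : OrdW P l) :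
    l < k := by
  obtain ⟨p, rfl, hpk, hp0⟩ := h
  obtain ⟨q, hq, hq0, rfl⟩ := (ordW_iff _ _).1 hl
  obtain rfl := op_injective hq
  refine lt_of_le_of_ne hpk fun heq => leadingCoeff_ne_zero.2 hq0 ?_
  rw [leadingCoeff, heq, hp0, C_0]

/-- The centralizer of `L` in the Weyl algebra, as a subalgebra. -/
noncomputable def weylCentralizer (L : Module.End ℂ ℂ[X]) :
    Subalgebra ℂ (Module.End ℂ ℂ[X]) where
  carrier := {P | InCentW L P}
  mul_mem' := fun {P Q} hP hQ => ⟨inWeyl_mul hP.1 hQ.1, by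
    rw [mul_assoc, hQ.2, ← mul_assoc, hP.2, mul_assoc]⟩
  add_mem' := fun {P Q} hP hQ => ⟨by
    obtain ⟨p, rfl⟩ := (inWeyl_iff _).1 hP.1
    obtain ⟨q, rfl⟩ := (inWeyl_iff _).1 hQ.1
    exact (inWeyl_iff _).2 ⟨p + q, (map_add _ _ _).symm⟩, by rw [add_mul, mul_add, hP.2, hQ.2]⟩
  algebraMap_mem' := fun c => ⟨(hasLead_algebraMap c).inWeyl, Algebra.commutes c L⟩

lemma mem_weylCentralizer {L P : Module.End ℂ ℂ[X]} : P ∈ weylCentralizer L ↔ InCentW L P :=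
  Iff.rfl

/-- Division with remainder in a centralizer, by descent on the order. -/
lemma exists_eq_aeval_add_aeval_mul {L B : Module.End ℂ ℂ[X]} {b : ℕ} (hL : HasLead L 4 1)
    (hB : HasLead B b 1) (hLC : L ∈ weylCentralizer L) (hBC : B ∈ weylCentralizer L)
    (hord : ∀ P ∈ weylCentralizer L, P ≠ 0 →
      ∃ k c, HasLead P k c ∧ c ≠ 0 ∧ ∃ l, k = 4 * l ∨ k = 4 * l + b)
    {P : Module.End ℂ ℂ[X]} (hP : P ∈ weylCentralizer L) :
    ∃ f h : ℂ[X], P = aeval L f + aeval L h * B := by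
  have key : ∀ n, ∀ P ∈ weylCentralizer L, (∀ k, OrdW P k → k < n) →
      ∃ f h : ℂ[X], P = aeval L f + aeval L h * B := by
    intro n
    induction n with
    | zero =>
      intro P hP hlt
      by_cases hP0 : P = 0
      · exact ⟨0, 0, by simp [hP0]⟩
      · obtain ⟨k, c, hk, hc, -⟩ := hord P hP hP0
        exact absurd (hlt k (hk.ordW hc)) (Nat.not_lt_zero k)
    | succ n ih =>
      intro P hP hlt
      by_cases hP0 : P = 0
      · exact ⟨0, 0, by simp [hP0]⟩
      obtain ⟨k, c, hk, hc, l, hl⟩ := hord P hP hP0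
      have hkn : k ≤ n := Nat.lt_succ_iff.1 (hlt k (hk.ordW hc))
      rcases hl with rfl | rfl
      · have h0 := hk.sub ((hL.pow l).smul c)
        rw [mul_one, sub_self] at h0
        obtain ⟨f, h, hfh⟩ := ih _
          (sub_mem hP ((weylCentralizer L).smul_mem (pow_mem hLC l) c))
          fun k' hk' => (h0.lt_of_zero hk').trans_le hkn
        refine ⟨f + C c * X ^ l, h, ?_⟩
        rw [map_add, map_mul, aeval_C, map_pow, aeval_X, ← Algebra.smul_def, add_right_comm, ← hfh,
          sub_add_cancel]
      · have h0 := hk.sub (((hL.pow l).mul hB).smul c)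
        rw [mul_one, mul_one, sub_self] at h0
        obtain ⟨f, h, hfh⟩ := ih _
          (sub_mem hP ((weylCentralizer L).smul_mem (mul_mem (pow_mem hLC l) hBC) c))
          fun k' hk' => (h0.lt_of_zero hk').trans_le hkn
        refine ⟨f, h + C c * X ^ l, ?_⟩
        rw [map_add, map_mul, aeval_C, map_pow, aeval_X, ← Algebra.smul_def, add_mul, ← add_assoc,
          ← hfh, smul_mul_assoc, sub_add_cancel]
  by_cases hP0 : P = 0
  · exact ⟨0, 0, by simp [hP0]⟩
  · obtain ⟨k, c, hk, hc, -⟩ := hord P hP hP0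
    exact key (k + 1) P hP fun k' hk' => by rw [ordW_unique hk' (hk.ordW hc)]; exact k.lt_succ_self

/-- The full symbol of `(∂² + V)² + U ∂ + W`. -/
noncomputable def quarticSymbol (U V W : ℂ[X]) : ℂ[X][X] :=
  X ^ 4 + C (2 * V) * X ^ 2 + C (2 * derivative V + U) * X +
    C (derivative (derivative V) + V ^ 2 + W)

lemma op_quarticSymbol (U V W : ℂ[X]) :
    op (quarticSymbol U V W) = (Wd ^ 2 + mulP V) ^ 2 + mulP U * Wd + mulP W := by
  have h : quarticSymbol U V W = monomial 4 1 + monomial 2 (2 * V) +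
      monomial 1 (2 * derivative V + U) + monomial 0 (derivative (derivative V) + V ^ 2 + W) := by
    simp only [quarticSymbol, ← C_mul_X_pow_eq_monomial, C_1, one_mul, pow_one, pow_zero, mul_one]
  rw [h]
  simp only [map_add, op_monomial]
  refine LinearMap.ext fun f => ?_
  simp only [mulP, Wd, pow_succ, pow_zero, one_mul, mul_one, LinearMap.add_apply,
    Module.End.mul_apply, LinearMap.mulLeft_apply, map_add, derivative_mul]
  ring

lemma coeff_quarticSymbol_three (U V W : ℂ[X]) : (quarticSymbol U V W).coeff 3 = 0 := by
  simp only [quarticSymbol, coeff_add, coeff_C_mul, coeff_X_pow, coeff_X, coeff_C]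
  simp

lemma natDegree_quarticSymbol (U V W : ℂ[X]) : (quarticSymbol U V W).natDegree = 4 := by
  rw [quarticSymbol]
  compute_degree!

lemma monic_quarticSymbol (U V W : ℂ[X]) : (quarticSymbol U V W).Monic := by
  rw [Monic, leadingCoeff, natDegree_quarticSymbol]
  simp only [quarticSymbol, coeff_add, coeff_C_mul, coeff_X_pow, coeff_X, coeff_C]
  simp

/-- An operator of order two in the centralizer presents `L` as a quadratic polynomial
in that operator. -/
lemma exists_eq_aeval_of_order_two {L B : Module.End ℂ ℂ[X]} (hL : HasLead L 4 1)
    (hB : HasLead B 2 1) (hLC : L ∈ weylCentralizer L) (hBC : B ∈ weylCentralizer L)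
    (hord : ∀ P ∈ weylCentralizer L, P ≠ 0 → ∃ k c, HasLead P k c ∧ c ≠ 0 ∧ k % 2 = 0) :
    ∃ f : ℂ[X], f.natDegree = 2 ∧ L = aeval B f := by
  have hconst : ∀ P ∈ weylCentralizer L, HasLead P 2 0 → ∃ c, P = algebraMap ℂ _ c := by
    intro P hP h2
    by_cases hP0 : P = 0
    · exact ⟨0, by simp [hP0]⟩
    obtain ⟨k, c, hk, hc, heven⟩ := hord P hP hP0
    have hk2 := h2.lt_of_zero (hk.ordW hc)
    obtain rfl : k = 0 := by omega
    refine ⟨c, ?_⟩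
    have h0 := hk.sub (hasLead_algebraMap c)
    rw [sub_self] at h0
    by_contra hne
    obtain ⟨l, d, hl, hd, -⟩ := hord _ (sub_mem hP ((weylCentralizer L).algebraMap_mem c))
      (sub_ne_zero.2 hne)
    exact absurd (h0.lt_of_zero (hl.ordW hd)) (Nat.not_lt_zero l)
  have hquad : ∃ c, HasLead (L - B ^ 2) 2 c := by
    have h0 := hL.sub (hB.pow 2)
    rw [sub_self] at h0
    by_cases hD : L - B ^ 2 = 0
    · exact ⟨0, by rw [hD]; simpa using (hasLead_algebraMap 0).of_lt two_pos⟩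
    obtain ⟨k, c, hk, hc, heven⟩ := hord _ (sub_mem hLC (pow_mem hBC 2)) hD
    have hk4 := h0.lt_of_zero (hk.ordW hc)
    rcases (show k = 0 ∨ k = 2 by omega) with rfl | rfl
    · exact ⟨0, hk.of_lt two_pos⟩
    · exact ⟨c, hk⟩
  obtain ⟨c, hc⟩ := hquad
  have h0 := hc.sub (hB.smul c)
  rw [mul_one, sub_self] at h0
  obtain ⟨d, hd⟩ := hconst _ (sub_mem (sub_mem hLC (pow_mem hBC 2))
    ((weylCentralizer L).smul_mem hBC c)) h0
  refine ⟨X ^ 2 + C c * X + C d, by compute_degree!, ?_⟩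
  simp only [map_add, map_pow, map_mul, aeval_X, aeval_C]
  rw [← hd, ← Algebra.smul_def]
  abel

lemma aeval_add_aeval_mul_eq_zero {L B : Module.End ℂ ℂ[X]} {b : ℕ} (hL : HasLead L 4 1)
    (hB : HasLead B b 1) (hb : ¬ 4 ∣ b) {f h : ℂ[X]} (hfh : aeval L f + aeval L h * B = 0) :
    f = 0 ∧ h = 0 := by
  have hfl := hL.aeval (by norm_num) f
  have hhl := (hL.aeval (by norm_num) h).mul hB
  rw [mul_one] at hhl
  by_cases hf : f = 0
  · refine ⟨hf, by_contra fun hh => ne_zero_of_ordW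
      (hhl.ordW (leadingCoeff_ne_zero.2 hh)) ?_⟩
    simpa [hf] using hfh
  · have hfo := hfl.ordW (leadingCoeff_ne_zero.2 hf)
    by_cases hh : h = 0
    · exact absurd (by simpa [hh] using hfh) (ne_zero_of_ordW hfo)
    · have hho := (hhl.smul (-1)).ordW (mul_ne_zero (by norm_num) (leadingCoeff_ne_zero.2 hh))
      have heq : aeval L f = (-1 : ℂ) • (aeval L h * B) := by
        rw [eq_neg_of_add_eq_zero_left hfh]
        exact LinearMap.ext fun u => by simp
      rw [heq] at hfo
      have := ordW_unique hfo hho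
      omega

end WeylSymbol

/-- Let `L₄ = (∂² + V)² + U ∂ + W` be irreducible of order 4 in `A₁(ℂ)`
with `𝒞(L₄) ≠ ℂ[L₄]`.  Then there is `X₂ ∈ 𝒞(L₄)` of minimal order among elements with
order `≡ 2 (mod 4)`, with `ord X₂ = 2(2g+1)` for some `g ≥ 1`, such that `𝒞(L₄)` is the
free `ℂ[L₄]`-module with basis `{1, X₂}` (so `𝒞(L₄) = ℂ[L₄, X₂]`), and the pair
`L₄, X₂` is a BC pair of true rank 2. -/
theorem statement17 (U V W : Polynomial ℂ)
    (L4 : Module.End ℂ (Polynomial ℂ))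
    (hL4 : L4 = (Wd ^ 2 + mulP V) ^ 2 + mulP U * Wd + mulP W)
    (hirr : IrreducibleOp L4)
    (hbig : ∃ M : Module.End ℂ (Polynomial ℂ), InCentW L4 M ∧
      ¬ ∃ p : Polynomial ℂ, M = Polynomial.aeval L4 p) :
    ∃ (X2 : Module.End ℂ (Polynomial ℂ)) (g : ℕ), 1 ≤ g ∧
      InCentW L4 X2 ∧ OrdW X2 (2 * (2 * g + 1)) ∧
      -- minimality among elements of the centralizer of order ≡ 2 (mod 4)
      (∀ Q : Module.End ℂ (Polynomial ℂ), InCentW L4 Q →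
        ∀ k, OrdW Q k → k % 4 = 2 → 2 * (2 * g + 1) ≤ k) ∧
      -- 𝒞(L₄) is a free ℂ[L₄]-module with basis {1, X₂}
      (∀ P : Module.End ℂ (Polynomial ℂ), InCentW L4 P →
        ∃! cc : Polynomial ℂ × Polynomial ℂ,
          P = Polynomial.aeval L4 cc.1 + Polynomial.aeval L4 cc.2 * X2) ∧
      -- L₄, X₂ is a BC pair : ℂ[L₄, X₂] = 𝒞(L₄)
      (∀ P : Module.End ℂ (Polynomial ℂ),
        P ∈ Algebra.adjoin ℂ ({L4, X2} : Set (Module.End ℂ (Polynomial ℂ))) ↔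
          InCentW L4 P) ∧
      -- L₄, X₂ is a true rank 2 pair
      (∀ P ∈ Algebra.adjoin ℂ ({L4, X2} : Set (Module.End ℂ (Polynomial ℂ))),
        P ≠ 0 → ∀ k, OrdW P k → 2 ∣ k) ∧
      (∀ d : ℕ,
        (∀ P ∈ Algebra.adjoin ℂ ({L4, X2} : Set (Module.End ℂ (Polynomial ℂ))),
          P ≠ 0 → ∀ k, OrdW P k → d ∣ k) → d ∣ 2) := by
  obtain ⟨p, hLp⟩ : ∃ p, p = WeylSymbol.quarticSymbol U V W := ⟨_, rfl⟩
  have hL : L4 = WeylSymbol.op p := by rw [hL4, hLp, WeylSymbol.op_quarticSymbol]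
  have hpm : p.Monic := hLp ▸ WeylSymbol.monic_quarticSymbol U V W
  have hp4 : p.natDegree = 4 := hLp ▸ WeylSymbol.natDegree_quarticSymbol U V W
  have hp3 : p.coeff 3 = 0 := hLp ▸ WeylSymbol.coeff_quarticSymbol_three U V W
  clear hL4 hLp
  have hlead : WeylSymbol.HasLead L4 4 1 :=
    ⟨p, hL, hp4.le, by rw [← hp4, hpm.coeff_natDegree, Polynomial.C_1]⟩
  have hLC : L4 ∈ WeylSymbol.weylCentralizer L4 := ⟨hlead.inWeyl, rfl⟩
  have hnc : ∃ j, 0 < (p.coeff j).natDegree := by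
    by_contra! hcon
    have hmap : p = (p.map Polynomial.constantCoeff).map Polynomial.C := by
      ext1 j
      rw [Polynomial.coeff_map, Polynomial.coeff_map]
      exact Polynomial.eq_C_of_natDegree_le_zero (hcon j)
    rw [hL, hmap, WeylSymbol.op_map_C] at hirr
    refine WeylSymbol.not_irreducibleOp_aeval WeylSymbol.hasLead_Wd one_pos ?_ hirr
    rw [hpm.natDegree_map, hp4]
    norm_num
  have hord : ∀ P ∈ WeylSymbol.weylCentralizer L4, P ≠ 0 →
      ∃ k c, WeylSymbol.HasLead P k c ∧ c ≠ 0 ∧ k % 2 = 0 := by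
    rintro P ⟨hPW, hPL⟩ hP0
    obtain ⟨q, rfl⟩ := (WeylSymbol.inWeyl_iff P).1 hPW
    have hq0 : q ≠ 0 := fun h0 => hP0 (by rw [h0, map_zero])
    rw [hL] at hPL
    have hlc := Polynomial.eq_C_of_derivative_eq_zero
      (WeylSymbol.derivative_leadingCoeff_eq_zero hpm (by omega) hPL.symm)
    refine ⟨q.natDegree, q.leadingCoeff.coeff 0, ⟨q, rfl, le_rfl, hlc⟩, fun h0 => ?_,
      WeylSymbol.even_natDegree_of_commute hpm hp4 hp3 hnc hq0 hPL.symm⟩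
    rw [h0, Polynomial.C_0] at hlc
    exact Polynomial.leadingCoeff_ne_zero.2 hq0 hlc
  have hex : ∃ k, k % 4 = 2 ∧ ∃ P ∈ WeylSymbol.weylCentralizer L4, OrdW P k := by
    by_contra! hcon
    obtain ⟨M, hM, hMp⟩ := hbig
    obtain ⟨f, h, hfh⟩ := WeylSymbol.exists_eq_aeval_add_aeval_mul (B := 1) (b := 0) hlead
      (by simpa using WeylSymbol.hasLead_algebraMap 1) hLC (one_mem _) (by
        intro P hP hP0
        obtain ⟨k, c, hk, hc, heven⟩ := hord P hP hP0
        have h2 : k % 4 ≠ 2 := fun h2 => hcon k h2 P hP (hk.ordW hc)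
        exact ⟨k, c, hk, hc, k / 4, by omega⟩) (WeylSymbol.mem_weylCentralizer.2 hM)
    exact hMp ⟨f + h, by rw [hfh, map_add, mul_one]⟩
  classical
  obtain ⟨b, hb⟩ : ∃ b, b = Nat.find hex := ⟨_, rfl⟩
  obtain ⟨hb2, Y, hYC, hYord⟩ := Nat.find_spec hex
  rw [← hb] at hb2 hYord
  have hmin : ∀ Q, InCentW L4 Q → ∀ k, OrdW Q k → k % 4 = 2 → b ≤ k := fun Q hQ k hk h2 =>
    hb ▸ Nat.find_min' hex ⟨h2, Q, hQ, hk⟩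
  obtain ⟨k, c, hk, hc, -⟩ := hord Y hYC (WeylSymbol.ne_zero_of_ordW hYord)
  obtain rfl := WeylSymbol.ordW_unique hYord (hk.ordW hc)
  obtain ⟨B, hBdef⟩ : ∃ B, B = c⁻¹ • Y := ⟨_, rfl⟩
  have hB : WeylSymbol.HasLead B b 1 := by
    rw [hBdef, ← inv_mul_cancel₀ hc]
    exact hk.smul c⁻¹
  have hBC : B ∈ WeylSymbol.weylCentralizer L4 :=
    hBdef ▸ (WeylSymbol.weylCentralizer L4).smul_mem hYC c⁻¹
  have hb0 : b ≠ 2 := by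
    rintro rfl
    obtain ⟨f, hf, hLf⟩ := WeylSymbol.exists_eq_aeval_of_order_two hlead hB hLC hBC hord
    exact WeylSymbol.not_irreducibleOp_aeval hB two_pos hf.ge (hLf ▸ hirr)
  obtain ⟨g, hg⟩ : ∃ g, b = 2 * (2 * g + 1) := ⟨b / 4, by omega⟩
  have hdec : ∀ P, InCentW L4 P → ∃ f h : Polynomial ℂ,
      P = Polynomial.aeval L4 f + Polynomial.aeval L4 h * B := fun P hP =>
    WeylSymbol.exists_eq_aeval_add_aeval_mul hlead hB hLC hBC (by
      intro P hP hP0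
      obtain ⟨k, c, hk, hc, heven⟩ := hord P hP hP0
      have := hmin P hP k (hk.ordW hc)
      by_cases h4 : k % 4 = 2
      · exact ⟨k, c, hk, hc, (k - b) / 4, by have := this h4; omega⟩
      · exact ⟨k, c, hk, hc, k / 4, by omega⟩) (WeylSymbol.mem_weylCentralizer.2 hP)
  have hLmem : L4 ∈ Algebra.adjoin ℂ ({L4, B} : Set (Module.End ℂ (Polynomial ℂ))) :=
    Algebra.subset_adjoin (by simp)
  have hBmem : B ∈ Algebra.adjoin ℂ ({L4, B} : Set (Module.End ℂ (Polynomial ℂ))) :=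
    Algebra.subset_adjoin (by simp)
  have hadj : ∀ P, P ∈ Algebra.adjoin ℂ ({L4, B} : Set (Module.End ℂ (Polynomial ℂ))) ↔
      InCentW L4 P := by
    intro P
    constructor
    · intro hP
      have hle : Algebra.adjoin ℂ ({L4, B} : Set (Module.End ℂ (Polynomial ℂ))) ≤
          WeylSymbol.weylCentralizer L4 := by
        rw [Algebra.adjoin_le_iff]
        rintro Q (rfl | rfl)
        · exact hLC
        · exact hBC
      exact hle hP
    · intro hP
      obtain ⟨f, h, rfl⟩ := hdec P hP
      have hsub : ∀ f : Polynomial ℂ, Polynomial.aeval L4 f ∈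
          Algebra.adjoin ℂ ({L4, B} : Set (Module.End ℂ (Polynomial ℂ))) := fun f =>
        Algebra.adjoin_mono (by simp) (Polynomial.aeval_mem_adjoin_singleton ℂ L4)
      exact add_mem (hsub f) (mul_mem (hsub h) hBmem)
  have hLord := hlead.ordW one_ne_zero
  have hBord := hB.ordW one_ne_zero
  refine ⟨B, g, by omega, hBC, hg ▸ hBord, hg ▸ hmin, ?_, hadj, ?_, ?_⟩
  · intro P hP
    obtain ⟨f, h, hfh⟩ := hdec P hP
    refine ⟨(f, h), hfh, ?_⟩
    rintro ⟨f', h'⟩ hfh'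
    have hzero : Polynomial.aeval L4 (f' - f) + Polynomial.aeval L4 (h' - h) * B = 0 := by
      rw [map_sub, map_sub, sub_mul]
      have := hfh'.symm.trans hfh
      simp only at this
      rw [sub_add_sub_comm, this, sub_self]
    obtain ⟨h1, h2⟩ := WeylSymbol.aeval_add_aeval_mul_eq_zero hlead hB (by omega) hzero
    rw [sub_eq_zero.1 h1, sub_eq_zero.1 h2]
  · intro P hP hP0 k hk
    obtain ⟨l, c, hl, hc, heven⟩ := hord P ((hadj P).1 hP) hP0
    rw [WeylSymbol.ordW_unique hk (hl.ordW hc)]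
    exact Nat.dvd_of_mod_eq_zero heven
  · intro d hd
    have h1 := hd L4 hLmem (WeylSymbol.ne_zero_of_ordW hLord) 4 hLord
    have h2 := hd B hBmem (WeylSymbol.ne_zero_of_ordW hBord) b hBord
    have h3 : b = 4 * g + 2 := by omega
    rw [h3] at h2
    exact (Nat.dvd_add_right (h1.mul_right g)).1 h2
end
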